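/- For every mixed ladder determinantal ideal I_t(L), the quotient ring K[L]/I_t(L) is a Cohen–Macaulay ring. -/

import Mathlib

open MvPolynomial

/-- The data of a two-sided ladder inside an `m × n` matrix of indeterminates,
with upper outside corners `(b i, a i)` and lower outside corners `(d j, c j)`,
together with a vector `t` of minor sizes, subject to the standing assumptions. -/
structure LadderData where
  m : ℕ
  n : ℕ
  h : ℕ
  k : ℕ
  hpos : 0 < h
  kpos : 0 < k
  hmn : m ≤ n
  b : Fin h → ℕ
  a : Fin h → ℕ
  d : Fin k → ℕ
  c : Fin k → ℕ
  t : Fin k → ℕ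
  b_mono : StrictMono b
  a_mono : StrictMono a
  b_first : b ⟨0, hpos⟩ = 1
  b_le : ∀ i, b i ≤ m
  a_pos : ∀ i, 1 ≤ a i
  a_last : a ⟨h - 1, Nat.sub_lt hpos Nat.one_pos⟩ = n
  d_mono : Monotone d
  c_mono : Monotone c
  d_pos : ∀ j, 1 ≤ d j
  d_last : d ⟨k - 1, Nat.sub_lt kpos Nat.one_pos⟩ = m
  c_first : c ⟨0, kpos⟩ = 1
  c_le : ∀ j, c j ≤ n
  corners_distinct : ∀ j j' : Fin k, d j = d j' → c j = c j' → j = j'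
  t_pos : ∀ j, 1 ≤ t j
  step_d : ∀ (j : ℕ) (hj : j + 1 < k),
    d ⟨j, Nat.lt_of_succ_lt hj⟩ + t ⟨j + 1, hj⟩ < d ⟨j + 1, hj⟩ + t ⟨j, Nat.lt_of_succ_lt hj⟩
  step_c : ∀ (j : ℕ) (hj : j + 1 < k),
    c ⟨j, Nat.lt_of_succ_lt hj⟩ + t ⟨j, Nat.lt_of_succ_lt hj⟩ < c ⟨j + 1, hj⟩ + t ⟨j + 1, hj⟩

namespace LadderData

/-- The set of positions (row, column) of the indeterminates of the ladder `L`. -/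
def L (D : LadderData) : Set (ℕ × ℕ) :=
  {p | ∃ (i : Fin D.h) (j : Fin D.k),
    D.b i ≤ p.1 ∧ p.1 ≤ D.m ∧ 1 ≤ p.2 ∧ p.2 ≤ D.a i ∧
    1 ≤ p.1 ∧ p.1 ≤ D.d j ∧ D.c j ≤ p.2 ∧ p.2 ≤ D.n}

/-- The one-sided subladder `L_j` with lower outside corner `(d j, c j)`. -/
def Lj (D : LadderData) (j : Fin D.k) : Set (ℕ × ℕ) :=
  {p ∈ D.L | p.1 ≤ D.d j ∧ D.c j ≤ p.2}

end LadderData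

/-- The ideal of `K[V]` (`V` a set of positions of indeterminates) generated by the
`s × s` minors of the generic matrix all of whose entries lie in `S`. -/
noncomputable def minorsIdeal (K : Type*) [Field K] (V S : Set (ℕ × ℕ)) (s : ℕ) :
    Ideal (MvPolynomial ↥V K) :=
  Ideal.span {f | ∃ r cc : Fin s → ℕ, StrictMono r ∧ StrictMono cc ∧
    (∀ p q, (r p, cc q) ∈ S) ∧
    ∃ hmem : ∀ p q, ((r p, cc q) : ℕ × ℕ) ∈ V,
    f = (Matrix.of fun p q =>
      (MvPolynomial.X (⟨(r p, cc q), hmem p q⟩ : V) : MvPolynomial ↥V K)).det}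

/-- The mixed ladder determinantal ideal `I_t(L) = I_{t_1}(L_1) + ⋯ + I_{t_k}(L_k) ⊆ K[L]`. -/
noncomputable def LadderData.It (D : LadderData) (K : Type*) [Field K] :
    Ideal (MvPolynomial ↥D.L K) :=
  ⨆ j : Fin D.k, minorsIdeal K D.L (D.Lj j) (D.t j)

/-- Every entry of the ladder is involved in one of the minors generating `I_t(L)`. -/
def LadderData.Nondeg (D : LadderData) : Prop :=
  ∀ p ∈ D.L, ∃ (j : Fin D.k) (r cc : Fin (D.t j) → ℕ),
    StrictMono r ∧ StrictMono cc ∧ (∀ u v, (r u, cc v) ∈ D.Lj j) ∧ ∃ u v, (r u, cc v) = p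

/-- A Noetherian commutative ring is Cohen–Macaulay if, for every maximal ideal `P`,
the local ring `R_P` admits a regular sequence contained in its maximal ideal whose
length equals its Krull dimension (i.e. depth `R_P` = dim `R_P`). -/
def IsCohenMacaulayRing (R : Type*) [CommRing R] : Prop :=
  IsNoetherianRing R ∧ ∀ (P : Ideal R) (_ : P.IsMaximal),
    ∃ rs : List (Localization.AtPrime P),
      (∀ x ∈ rs, x ∈ IsLocalRing.maximalIdeal (Localization.AtPrime P)) ∧
      RingTheory.Sequence.IsRegular (Localization.AtPrime P) rs ∧
      (rs.length : WithBot (WithTop ℕ)) = ringKrullDim (Localization.AtPrime P)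

open Polynomial in
/-- If the fractions `r i / q i` all agree modulo a prime `N`, then the polynomials
`X * q i + r i` together with `N` generate a prime ideal, provided that `r i₀` is a
nonzerodivisor modulo `N` and the `q i`. -/
theorem Polynomial.isPrime_map_C_sup_span_linear {R ι : Type*} [CommRing R] (N : Ideal R)
    [N.IsPrime] (q r : ι → R) (i₀ : ι) (hq : q i₀ ∉ N) (hrel : ∀ i, q i * r i₀ - q i₀ * r i ∈ N)
    (hC : ∀ p, p * r i₀ ∈ N ⊔ Ideal.span (Set.range q) → p ∈ N ⊔ Ideal.span (Set.range q)) :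
    (N.map (C : R →+* R[X]) ⊔
      Ideal.span (Set.range fun i => X * C (q i) + C (r i))).IsPrime := by
  set J := N ⊔ Ideal.span (Set.range q) with hJ
  set I := N.map (C : R →+* R[X]) ⊔ Ideal.span (Set.range fun i => X * C (q i) + C (r i)) with hI
  let φ : R →+* FractionRing (R ⧸ N) := (algebraMap (R ⧸ N) _).comp (Ideal.Quotient.mk N)
  have hφ : ∀ a, φ a = 0 ↔ a ∈ N := by
    intro a
    simp only [φ, RingHom.comp_apply]
    rw [IsFractionRing.to_map_eq_zero_iff, Ideal.Quotient.eq_zero_iff_mem]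
  have hq0 : φ (q i₀) ≠ 0 := fun h => hq ((hφ _).1 h)
  let z : FractionRing (R ⧸ N) := -φ (r i₀) / φ (q i₀)
  let ψ : R[X] →+* FractionRing (R ⧸ N) := eval₂RingHom φ z
  have hNI : N.map C ≤ I := le_sup_left
  have hle : I ≤ RingHom.ker ψ := by
    refine sup_le ?_ ?_
    · rw [Ideal.map_le_iff_le_comap]
      intro a ha
      simp only [Ideal.mem_comap, RingHom.mem_ker, ψ, coe_eval₂RingHom, eval₂_C]
      exact (hφ a).2 ha
    · rw [Ideal.span_le]
      rintro _ ⟨i, rfl⟩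
      have h := (hφ _).2 (hrel i)
      simp only [map_sub, map_mul] at h
      simp only [SetLike.mem_coe, RingHom.mem_ker, ψ, coe_eval₂RingHom, eval₂_add, eval₂_mul,
        eval₂_C, eval₂_X, z]
      field_simp
      linear_combination -h
  have hlin : ∀ a ∈ J, ∃ b, X * C a + C b ∈ I := by
    intro a ha
    rw [hJ, Submodule.mem_sup] at ha
    obtain ⟨n, hn, s, hs, rfl⟩ := ha
    have h1 : ∃ b, X * C s + C b ∈ I := by
      induction hs using Submodule.span_induction with
      | mem x hx =>
        obtain ⟨i, rfl⟩ := hx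
        exact ⟨r i, (le_sup_right : _ ≤ I) (Ideal.subset_span ⟨i, rfl⟩)⟩
      | zero => exact ⟨0, by simp⟩
      | add x y _ _ hx hy =>
        obtain ⟨b, hb⟩ := hx
        obtain ⟨b', hb'⟩ := hy
        refine ⟨b + b', ?_⟩
        convert I.add_mem hb hb' using 1
        simp only [map_add]; ring
      | smul c x _ hx =>
        obtain ⟨b, hb⟩ := hx
        refine ⟨c * b, ?_⟩
        convert I.mul_mem_left (C c) hb using 1
        simp only [smul_eq_mul, map_mul]; ring
    obtain ⟨b, hb⟩ := h1
    refine ⟨b, ?_⟩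
    convert I.add_mem (I.mul_mem_left X (hNI (Ideal.mem_map_of_mem C hn))) hb using 1
    simp only [map_add]; ring
  have hpow : ∀ k p, p * r i₀ ^ k ∈ J → p ∈ J := by
    intro k
    induction k with
    | zero => intro p hp; simpa using hp
    | succ k ih =>
      intro p hp
      exact ih p (hC _ (by rwa [pow_succ, ← mul_assoc] at hp))
  have hker : ∀ n, ∀ p : R[X], p.natDegree ≤ n → ψ p = 0 → p ∈ I := by
    intro n
    induction n with
    | zero =>
      intro p hp h
      obtain ⟨a, rfl⟩ := natDegree_eq_zero.1 (Nat.le_zero.1 hp)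
      simp only [ψ, coe_eval₂RingHom, eval₂_C] at h
      exact hNI (Ideal.mem_map_of_mem C ((hφ a).1 h))
    | succ n ih =>
      intro p hp h
      have hmem : ∑ k ∈ Finset.range (n + 2), p.coeff k * (-r i₀) ^ k * q i₀ ^ (n + 1 - k) ∈ N := by
        rw [← hφ]
        have : ψ p * φ (q i₀) ^ (n + 1) = 0 := by rw [h, zero_mul]
        rw [← this]
        simp only [ψ, coe_eval₂RingHom]
        rw [eval₂_eq_sum_range' φ (Nat.lt_succ_of_le hp), map_sum, Finset.sum_mul]
        refine Finset.sum_congr rfl fun k hk => ?_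
        have hk : k ≤ n + 1 := Nat.lt_succ_iff.1 (Finset.mem_range.1 hk)
        obtain ⟨l, hl⟩ := Nat.exists_eq_add_of_le hk
        simp only [map_mul, map_pow, map_neg, z]
        rw [hl, Nat.add_sub_cancel_left, pow_add, div_pow]
        field_simp
      have hlead : p.coeff (n + 1) ∈ J := by
        refine hpow (n + 1) _ ?_
        rw [Finset.sum_range_succ] at hmem
        have h1 : ∑ k ∈ Finset.range (n + 1), p.coeff k * (-r i₀) ^ k * q i₀ ^ (n + 1 - k) ∈ J := by
          refine Ideal.sum_mem _ fun k hk => ?_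
          refine J.mul_mem_left _ (Ideal.pow_mem_of_mem _ ?_ _ ?_)
          · exact (le_sup_right : _ ≤ J) (Ideal.subset_span ⟨i₀, rfl⟩)
          · have := Finset.mem_range.1 hk
            omega
        have h2 := J.sub_mem ((le_sup_left : N ≤ J) hmem) h1
        simp only [add_sub_cancel_left, Nat.sub_self, pow_zero, mul_one] at h2
        rcases neg_one_pow_eq_or R (n + 1) with h3 | h3
        · rwa [neg_pow, h3, one_mul] at h2
        · rw [neg_pow, h3] at h2
          simpa using h2
      obtain ⟨b, hb⟩ := hlin _ hlead
      have hsub : p - X ^ n * (X * C (p.coeff (n + 1)) + C b) ∈ I := by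
        refine ih _ ?_ ?_
        · rw [natDegree_le_iff_coeff_eq_zero]
          intro N' hN'
          have e : X ^ n * (X * C (p.coeff (n + 1)) + C b) =
              C (p.coeff (n + 1)) * X ^ (n + 1) + C b * X ^ n := by ring
          rw [e, coeff_sub, coeff_add, coeff_C_mul_X_pow, coeff_C_mul_X_pow, if_neg hN'.ne']
          split_ifs with h4
          · subst h4; simp
          · rw [coeff_eq_zero_of_natDegree_lt (by omega)]; simp
        · rw [map_sub, h, map_mul, show ψ (X * C (p.coeff (n + 1)) + C b) = 0 from hle hb]
          simp
      simpa using I.add_mem hsub (I.mul_mem_left (X ^ n) hb)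
  have : I = RingHom.ker ψ := le_antisymm hle fun p hp => hker _ p le_rfl hp
  rw [this]
  exact RingHom.ker_isPrime ψ

section

open RingTheory.Sequence

open Polynomial in
theorem Polynomial.isWeaklyRegular_map_C_append_monic {R : Type*} [CommRing R] {rs : List R}
    (h : IsWeaklyRegular R rs) {f : R[X]} (hf : f.Monic) :
    IsWeaklyRegular R[X] (rs.map C ++ [f]) := by
  rw [isWeaklyRegular_append_iff]
  refine ⟨h.of_flat, ?_⟩
  rw [isWeaklyRegular_singleton_iff, isSMulRegular_quotient_iff_mem_of_smul_mem]
  intro g hg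
  have e : (Ideal.ofList (rs.map (C : R →+* R[X])) • ⊤ : Submodule R[X] R[X]) =
      (Ideal.ofList rs).map C := by
    rw [← Ideal.map_ofList, smul_eq_mul, Ideal.mul_top]
  rw [e] at hg ⊢
  rw [← Ideal.mk_ker (I := Ideal.ofList rs), ← Polynomial.ker_mapRingHom, RingHom.mem_ker] at hg ⊢
  simp only [smul_eq_mul, map_mul, coe_mapRingHom] at hg ⊢
  exact (hf.map _).isRegular.left (by simpa using hg)

open Polynomial in
theorem Polynomial.exists_monic_mem_of_isMaximal {R : Type*} [CommRing R] [IsJacobsonRing R]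
    (P : Ideal R[X]) [P.IsMaximal] : ∃ f ∈ P, f.Monic := by
  have hm := Polynomial.isMaximal_comap_C_of_isJacobsonRing P
  have hne : P ≠ (P.comap C).map C := by
    intro h
    have hcoeff : ∀ g ∈ P, ∀ n, C (g.coeff n) ∈ P := fun g hg n =>
      Ideal.mem_map_C_iff.1 (h ▸ hg) n
    have hX : (X : R[X]) ∉ P := fun hX => by
      have := hcoeff X hX 1
      rw [coeff_X_one, map_one] at this
      exact ‹P.IsMaximal›.ne_top ((Ideal.eq_top_iff_one _).2 this)
    obtain ⟨y, i, hi, hy⟩ := ‹P.IsMaximal›.exists_inv hX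
    have := hcoeff i hi 0
    rw [← eq_sub_iff_add_eq'] at hy
    rw [hy] at this
    simp only [coeff_sub, coeff_one_zero, coeff_mul_X_zero, sub_zero, map_one] at this
    exact ‹P.IsMaximal›.ne_top ((Ideal.eq_top_iff_one _).2 this)
  obtain ⟨f, hf, h⟩ := Polynomial.exists_monic_span_sup_map_eq R P hm hne
  exact ⟨f, h ▸ Ideal.mem_sup_right (Ideal.mem_span_singleton_self f), hf⟩

theorem exists_isWeaklyRegular_of_ringEquiv {R S : Type*} [CommRing R] [CommRing S] (e : R ≃+* S)
    (n : ℕ) (h : ∀ P : Ideal R, P.IsMaximal →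
      ∃ rs : List R, rs.length = n ∧ (∀ r ∈ rs, r ∈ P) ∧ IsWeaklyRegular R rs)
    (P : Ideal S) (hP : P.IsMaximal) :
    ∃ rs : List S, rs.length = n ∧ (∀ r ∈ rs, r ∈ P) ∧ IsWeaklyRegular S rs := by
  have : (P.comap e).IsMaximal := Ideal.comap_isMaximal_of_equiv e
  obtain ⟨rs, h1, h2, h3⟩ := h _ this
  refine ⟨rs.map e, by simpa using h1, by simpa using h2, ?_⟩
  refine (AddEquiv.isWeaklyRegular_congr (e := e.toAddEquiv) (as := rs) ?_).1 h3
  rw [List.forall₂_map_right_iff, List.forall₂_same]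
  intro a _ x
  simp

theorem MvPolynomial.exists_isWeaklyRegular_of_isMaximal {K : Type*} [Field K] (σ : Type*)
    [Finite σ] (P : Ideal (MvPolynomial σ K)) (hP : P.IsMaximal) :
    ∃ rs : List (MvPolynomial σ K), rs.length = Nat.card σ ∧ (∀ r ∈ rs, r ∈ P) ∧
      IsWeaklyRegular (MvPolynomial σ K) rs := by
  revert P
  induction σ using Finite.induction_empty_option with
  | of_equiv e h =>
    intro P hP
    rw [← Nat.card_congr e]
    exact exists_isWeaklyRegular_of_ringEquiv (MvPolynomial.renameEquiv K e).toRingEquiv _ h P hP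
  | h_empty =>
    intro P hP
    exact ⟨[], by simp, by simp, IsWeaklyRegular.nil _ _⟩
  | h_option h =>
    rename_i α _
    refine exists_isWeaklyRegular_of_ringEquiv
      (MvPolynomial.optionEquivLeft K α).symm.toRingEquiv _ ?_
    intro P hP
    have hm := Polynomial.isMaximal_comap_C_of_isJacobsonRing P
    obtain ⟨rs, h1, h2, h3⟩ := h _ hm
    obtain ⟨f, hf, hfm⟩ := Polynomial.exists_monic_mem_of_isMaximal P
    refine ⟨_, ?_, ?_, Polynomial.isWeaklyRegular_map_C_append_monic h3 hfm⟩
    · simp [h1]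
    · simp only [List.mem_append, List.mem_map, List.mem_singleton]
      rintro r (⟨a, ha, rfl⟩ | rfl)
      · exact h2 a ha
      · exact hf

open CategoryTheory in
theorem MvPolynomial.subsingleton_ext_of_isMaximal.{u, v} {K : Type u} [Field K] (σ : Type v)
    [Finite σ] (P : Ideal (MvPolynomial σ K)) (hP : P.IsMaximal) (i : ℕ) (hi : i < Nat.card σ) :
    Subsingleton (Abelian.Ext (ModuleCat.of (MvPolynomial σ K) (MvPolynomial σ K ⧸ P))
      (ModuleCat.of (MvPolynomial σ K) (MvPolynomial σ K)) i) := by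
  obtain ⟨rs, h1, h2, h3⟩ := MvPolynomial.exists_isWeaklyRegular_of_isMaximal σ P hP
  refine ModuleCat.subsingleton_ext_of_exists_isRegular P _ ?_ _ ?_ rs h2 ?_ i (h1 ▸ hi)
  · simp [Module.support_eq_zeroLocus, Ideal.annihilator_quotient]
  · simpa using hP.ne_top.lt_top
  · refine ⟨h3, ?_⟩
    intro h
    apply hP.ne_top
    rw [eq_top_iff]
    have : Ideal.ofList rs ≤ P := Ideal.span_le.2 h2
    simpa using (h ▸ le_refl _ : (⊤ : Ideal _) ≤ Ideal.ofList rs • ⊤).trans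
      ((by simp : _ ≤ Ideal.ofList rs).trans this)

end

open CategoryTheory Abelian in
theorem ModuleCat.subsingleton_ext_of_subsingleton.{v} {R : Type*} [CommRing R] [Small.{v} R]
    (X Y : ModuleCat.{v} R) [Subsingleton Y] (i : ℕ) : Subsingleton (Ext X Y i) := by
  refine subsingleton_of_forall_eq 0 fun x => ?_
  have h : (𝟙 Y : Y ⟶ Y) = 0 := by
    ext y
    exact Subsingleton.elim _ _
  rw [← Ext.comp_mk₀_id x, h, Ext.mk₀_zero, Ext.comp_zero]

theorem Submodule.shortComplex_factor_shortExact.{v} {R : Type*} [CommRing R] {M : Type v}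
    [AddCommGroup M] [Module R M] {N I : Submodule R M} (h : N ≤ I) :
    (CategoryTheory.ShortComplex.mk (ModuleCat.ofHom (I.map N.mkQ).subtype)
      (ModuleCat.ofHom (Submodule.factor h)) (by
        ext ⟨x, hx⟩
        obtain ⟨y, hy, rfl⟩ := hx
        simpa using hy)).ShortExact := by
  refine ModuleCat.shortComplex_shortExact _ ?_ Subtype.val_injective
    (Submodule.factor_surjective h)
  intro x
  obtain ⟨x, rfl⟩ := N.mkQ_surjective x
  suffices x ∈ I ↔ ∃ y ∈ I, Quotient.mk (p := N) y = Quotient.mk x by simpa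
  refine ⟨fun hx => ⟨x, hx, rfl⟩, ?_⟩
  rintro ⟨y, hy, hxy⟩
  have := I.sub_mem hy (h ((Submodule.Quotient.eq N).1 hxy))
  rwa [sub_sub_cancel] at this

open CategoryTheory Abelian in
/-- Linked quotients: if `C / N ≅ I / N`, then vanishing of `Ext X · i` passes from
`M / C` to `M / I`, provided that `Ext X (M / N)` vanishes in degrees `i` and `i + 1`. -/
theorem Submodule.subsingleton_ext_quotient_of_linearEquiv.{v} {R : Type*} [CommRing R]
    [Small.{v} R]
    {M : Type v} [AddCommGroup M] [Module R M] (X : ModuleCat.{v} R) {N C I : Submodule R M}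
    (hC : N ≤ C) (hI : N ≤ I) (e : C.map N.mkQ ≃ₗ[R] I.map N.mkQ) (i : ℕ)
    (h₀ : Subsingleton (Ext X (ModuleCat.of R (M ⧸ N)) i))
    (h₁ : Subsingleton (Ext X (ModuleCat.of R (M ⧸ N)) (i + 1)))
    (h₂ : Subsingleton (Ext X (ModuleCat.of R (M ⧸ C)) i)) :
    Subsingleton (Ext X (ModuleCat.of R (M ⧸ I)) i) := by
  have hCbar : Subsingleton (Ext X (ModuleCat.of R (C.map N.mkQ)) (i + 1)) := by
    refine subsingleton_of_forall_eq 0 fun x => ?_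
    obtain ⟨y, hy⟩ := Ext.covariant_sequence_exact₁ X (shortComplex_factor_shortExact hC) x
      (h₁.elim _ _) rfl
    rw [← hy, h₂.elim y 0, Ext.zero_comp]
  have hIbar : Subsingleton (Ext X (ModuleCat.of R (I.map N.mkQ)) (i + 1)) := by
    refine subsingleton_of_forall_eq 0 fun x => ?_
    rw [← Ext.comp_mk₀_id x, ← e.toModuleIso.inv_hom_id, ← Ext.mk₀_comp_mk₀,
      ← Ext.comp_assoc_of_second_deg_zero,
      hCbar.elim (x.comp (Ext.mk₀ e.toModuleIso.inv) (add_zero _)) 0, Ext.zero_comp]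
  refine subsingleton_of_forall_eq 0 fun x => ?_
  obtain ⟨y, hy⟩ := Ext.covariant_sequence_exact₃ X (shortComplex_factor_shortExact hI) x rfl
    (hIbar.elim _ _)
  rw [← hy, h₀.elim y 0, Ext.zero_comp]

theorem Ideal.exists_linearEquiv_map_mkQ_sup_span {R ι : Type*} [CommRing R] (N : Ideal R)
    [hN : N.IsPrime] (q f : ι → R) (i₀ : ι) (hq : q i₀ ∉ N) (hf : f i₀ ∉ N)
    (h : ∀ i, f i₀ * q i - q i₀ * f i ∈ N) :
    Nonempty (Submodule.map N.mkQ (N ⊔ Ideal.span (Set.range q)) ≃ₗ[R]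
      Submodule.map N.mkQ (N ⊔ Ideal.span (Set.range f))) := by
  have hinj : ∀ a, a ∉ N → Function.Injective (LinearMap.lsmul R (R ⧸ N) a) := by
    intro a ha
    rw [injective_iff_map_eq_zero]
    intro x hx
    obtain ⟨x, rfl⟩ := Ideal.Quotient.mk_surjective x
    rw [LinearMap.lsmul_apply, ← Ideal.Quotient.mk_eq_mk, ← Submodule.Quotient.mk_smul,
      Submodule.Quotient.mk_eq_zero, smul_eq_mul] at hx
    exact Ideal.Quotient.eq_zero_iff_mem.2 ((hN.mem_or_mem hx).resolve_left ha)
  have hmap : ∀ (g : ι → R) (a : R), Submodule.map (LinearMap.lsmul R (R ⧸ N) a)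
      (Submodule.map N.mkQ (N ⊔ Ideal.span (Set.range g))) =
      Submodule.span R (Set.range fun i => N.mkQ (a * g i)) := by
    intro g a
    have : Submodule.map N.mkQ N = ⊥ := by simp
    rw [Submodule.map_sup, this, bot_sup_eq, Ideal.span, Submodule.map_span, Submodule.map_span,
      ← Set.range_comp, ← Set.range_comp]
    rfl
  refine ⟨(Submodule.equivMapOfInjective _ (hinj _ hf) _).trans <|
    (LinearEquiv.ofEq _ _ ?_).trans (Submodule.equivMapOfInjective _ (hinj _ hq) _).symm⟩
  rw [hmap, hmap]
  congr 2
  ext1 i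
  rw [← sub_eq_zero, ← map_sub]
  exact (Submodule.Quotient.mk_eq_zero _).2 (h i)

namespace Matrix

theorem det_fromBlocks_unit_of_isRegular {ι R : Type*} [Fintype ι] [DecidableEq ι] [CommRing R]
    (A : Matrix ι ι R) (u : Matrix ι Unit R) (v : Matrix Unit ι R) (w : Matrix Unit Unit R)
    (h : IsRegular A.det) :
    (fromBlocks A u v w).det = w () () * A.det - (v * A.adjugate * u) () () := by
  have h1 : fromBlocks A u v w * fromBlocks 1 (-(A.adjugate * u)) 0 (of fun _ _ => A.det) =
      fromBlocks A 0 v (w * (of fun _ _ => A.det) - v * A.adjugate * u) := by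
    rw [fromBlocks_multiply]
    congr 1
    · simp
    · rw [Matrix.mul_neg, ← Matrix.mul_assoc, mul_adjugate]
      ext i j
      simp [Matrix.mul_apply, mul_comm]
    · simp
    · rw [Matrix.mul_neg, Matrix.mul_assoc]
      abel
  have h2 := congrArg det h1
  rw [det_mul, det_fromBlocks_zero₂₁, det_fromBlocks_zero₁₂, det_one, one_mul,
    det_unique (n := Unit) (of _), det_unique (n := Unit) (_ - _)] at h2
  refine h.right ?_
  change (fromBlocks A u v w).det * A.det = _ at h2
  simp only
  rw [h2, mul_comm]
  congr 1
  simp [Matrix.mul_apply]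

/-- The determinant of a bordered matrix over an arbitrary commutative ring. -/
theorem det_fromBlocks_unit {ι R : Type*} [Fintype ι] [DecidableEq ι] [CommRing R]
    (A : Matrix ι ι R) (u : Matrix ι Unit R) (v : Matrix Unit ι R) (w : Matrix Unit Unit R) :
    (fromBlocks A u v w).det = w () () * A.det - (v * A.adjugate * u) () () := by
  let φ : Polynomial R →+* R := Polynomial.evalRingHom 0
  let B : Matrix ι ι (Polynomial R) := (Polynomial.X : Polynomial R) • 1 + A.map Polynomial.C
  have hB : IsRegular B.det := by
    refine Polynomial.Monic.isRegular ?_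
    rw [Polynomial.Monic.def]
    exact Polynomial.leadingCoeff_det_X_one_add_C A
  have h := congrArg φ (det_fromBlocks_unit_of_isRegular B (u.map Polynomial.C) (v.map Polynomial.C)
    (w.map Polynomial.C) hB)
  have hBA : φ.mapMatrix B = A := by
    ext
    simp [B, φ]
  have hmap : (φ ∘ Polynomial.C : R → R) = id := by
    ext
    simp [φ]
  have hadj : B.adjugate.map φ = A.adjugate := by
    rw [← hBA, ← RingHom.map_adjugate]
    rfl
  rw [RingHom.map_det, RingHom.mapMatrix_apply, fromBlocks_map, map_sub, map_mul, RingHom.map_det,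
    hBA, ← RingHom.mapMatrix_apply φ B, hBA, map_map, map_map, map_map, hmap, map_id, map_id,
    map_id] at h
  rw [h]
  congr 2
  · simp [φ]
  · rw [← map_apply (f := φ), Matrix.map_mul, Matrix.map_mul, hadj, map_map, map_map, hmap,
      map_id, map_id]

/-- If bordering `A` by a column and the rows of `B`, and `A'` by a row and the columns of `B`,
only gives singular matrices, then the corresponding Schur complements agree up to scaling. -/
theorem det_mul_schur_eq {ι R : Type*} [Fintype ι] [DecidableEq ι] [CommRing R]
    (A A' B : Matrix ι ι R) (u u' : Matrix ι Unit R) (v v' : Matrix Unit ι R)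
    (hu : A.det • u' = B * A.adjugate * u) (hv : A'.det • v = v' * A'.adjugate * B) :
    A.det * (v' * A'.adjugate * u') () () = A'.det * (v * A.adjugate * u) () () := by
  have h : A.det • (v' * A'.adjugate * u') = A'.det • (v * A.adjugate * u) := by
    rw [← Matrix.mul_smul, hu, ← Matrix.smul_mul, ← Matrix.smul_mul, hv]
    simp only [Matrix.mul_assoc]
  have := congrFun (congrFun h ()) ()
  simpa using this

end Matrix

/-- The ideal generated by the `t × t` minors of the matrix `x` with all entries in `A`. -/
def entryMinors {R : Type*} [CommRing R] (x : ℕ × ℕ → R) (A : Set (ℕ × ℕ)) (t : ℕ) : Ideal R :=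
  Ideal.span {f | ∃ r c : Fin t → ℕ, StrictMono r ∧ StrictMono c ∧ (∀ p q, (r p, c q) ∈ A) ∧
    f = (Matrix.of fun p q => x (r p, c q)).det}

theorem entryMinors_mono {R : Type*} [CommRing R] (x : ℕ × ℕ → R) {A A' : Set (ℕ × ℕ)}
    (h : A ⊆ A') (t : ℕ) : entryMinors x A t ≤ entryMinors x A' t := by
  refine Ideal.span_mono ?_
  rintro _ ⟨r, c, hr, hc, hm, rfl⟩
  exact ⟨r, c, hr, hc, fun p q => h (hm p q), rfl⟩

theorem entryMinors_le {R : Type*} [CommRing R] {x : ℕ × ℕ → R} {A : Set (ℕ × ℕ)} {t : ℕ}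
    {I : Ideal R} (h : ∀ r c : Fin t → ℕ, StrictMono r → StrictMono c → (∀ p q, (r p, c q) ∈ A) →
      (Matrix.of fun p q => x (r p, c q)).det ∈ I) : entryMinors x A t ≤ I := by
  refine Ideal.span_le.2 ?_
  rintro _ ⟨r, c, hr, hc, hm, rfl⟩
  exact h r c hr hc hm

/-- Minors with arbitrary, possibly repeated and unordered, rows and columns. -/
theorem det_mem_entryMinors {R : Type*} [CommRing R] (x : ℕ × ℕ → R) (A : Set (ℕ × ℕ))
    {ι : Type*} [Fintype ι] [DecidableEq ι] (r c : ι → ℕ) (h : ∀ p q, (r p, c q) ∈ A) :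
    (Matrix.of fun p q => x (r p, c q)).det ∈ entryMinors x A (Fintype.card ι) := by
  by_cases hr : Function.Injective r
  swap
  · rw [Function.Injective] at hr
    push Not at hr
    obtain ⟨a, b, hab, hne⟩ := hr
    rw [Matrix.det_zero_of_row_eq hne (by ext q; simp [hab])]
    exact Ideal.zero_mem _
  by_cases hc : Function.Injective c
  swap
  · rw [Function.Injective] at hc
    push Not at hc
    obtain ⟨a, b, hab, hne⟩ := hc
    rw [Matrix.det_zero_of_column_eq hne (by intro q; simp [hab])]
    exact Ideal.zero_mem _
  let e := (Fintype.equivFin ι).symm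
  let σ := Tuple.sort (r ∘ e)
  let τ := Tuple.sort (c ∘ e)
  have hr' : StrictMono ((r ∘ e) ∘ σ) :=
    (Tuple.monotone_sort _).strictMono_of_injective ((hr.comp e.injective).comp σ.injective)
  have hc' : StrictMono ((c ∘ e) ∘ τ) :=
    (Tuple.monotone_sort _).strictMono_of_injective ((hc.comp e.injective).comp τ.injective)
  have hmem : (Matrix.of fun p q => x (((r ∘ e) ∘ σ) p, ((c ∘ e) ∘ τ) q)).det ∈
      entryMinors x A (Fintype.card ι) :=
    Ideal.subset_span ⟨_, _, hr', hc', fun p q => h _ _, rfl⟩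
  have e1 : (Matrix.of fun p q => x (((r ∘ e) ∘ σ) p, ((c ∘ e) ∘ τ) q)) =
      (((Matrix.of fun p q => x (r p, c q)).submatrix e e).submatrix σ id).submatrix id τ := rfl
  rw [e1, Matrix.det_permute', Matrix.det_permute, Matrix.det_submatrix_equiv_self] at hmem
  have hu : ∀ s : ℤˣ, ((s : ℤ) : R) * ((s : ℤ) : R) = 1 := fun s => by
    rw [← Int.cast_mul, ← Units.val_mul, Int.units_mul_self]; simp
  have := Ideal.mul_mem_left _ (((Equiv.Perm.sign σ : ℤ) : R) * ((Equiv.Perm.sign τ : ℤ) : R)) hmem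
  convert this using 1
  linear_combination (-(Matrix.of fun p q => x (r p, c q)).det) * (hu (Equiv.Perm.sign σ)) -
    (Matrix.of fun p q => x (r p, c q)).det * ((Equiv.Perm.sign σ : ℤ) : R)^2 *
      (hu (Equiv.Perm.sign τ))

theorem map_entryMinors {R S : Type*} [CommRing R] [CommRing S] (φ : R →+* S) (x : ℕ × ℕ → R)
    (A : Set (ℕ × ℕ)) (t : ℕ) : (entryMinors x A t).map φ = entryMinors (φ ∘ x) A t := by
  rw [entryMinors, entryMinors, Ideal.map_span]
  congr 1
  ext f
  constructor
  · rintro ⟨_, ⟨r, c, hr, hc, hm, rfl⟩, rfl⟩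
    exact ⟨r, c, hr, hc, hm, by rw [RingHom.map_det]; rfl⟩
  · rintro ⟨r, c, hr, hc, hm, rfl⟩
    exact ⟨_, ⟨r, c, hr, hc, hm, rfl⟩, by rw [RingHom.map_det]; rfl⟩

theorem entryMinors_congr {R : Type*} [CommRing R] {x x' : ℕ × ℕ → R} {A : Set (ℕ × ℕ)}
    (h : ∀ p ∈ A, x p = x' p) (t : ℕ) : entryMinors x A t = entryMinors x' A t := by
  have key : ∀ {x x' : ℕ × ℕ → R}, (∀ p ∈ A, x p = x' p) →
      entryMinors x A t ≤ entryMinors x' A t := by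
    intro x x' h
    refine entryMinors_le fun r c hr hc hm => Ideal.subset_span ⟨r, c, hr, hc, hm, ?_⟩
    congr 2
    ext p q
    exact h _ (hm p q)
  exact le_antisymm (key h) (key fun p hp => (h p hp).symm)

/-- Laplace expansion along the last row. -/
theorem entryMinors_succ_le_of_rows {R : Type*} [CommRing R] (x : ℕ × ℕ → R) {A A' : Set (ℕ × ℕ)}
    (h : ∀ i i' j, i < i' → (i, j) ∈ A' → (i', j) ∈ A' → (i, j) ∈ A) (t : ℕ) :
    entryMinors x A' (t + 1) ≤ entryMinors x A t := by
  refine entryMinors_le fun r c hr hc hm => ?_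
  rw [Matrix.det_succ_row _ (Fin.last t)]
  refine Ideal.sum_mem _ fun j _ => Ideal.mul_mem_left _ _ (Ideal.subset_span
    ⟨r ∘ Fin.castSucc, c ∘ j.succAbove, hr.comp Fin.strictMono_castSucc,
      hc.comp (Fin.strictMono_succAbove j), fun p q => ?_, ?_⟩)
  · exact h _ _ _ (hr (Fin.castSucc_lt_last p)) (hm _ _) (hm (Fin.last t) _)
  · rw [Fin.succAbove_last]
    rfl

/-- Laplace expansion along the first column. -/
theorem entryMinors_succ_le_of_columns {R : Type*} [CommRing R] (x : ℕ × ℕ → R)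
    {A A' : Set (ℕ × ℕ)} (h : ∀ i j j', j' < j → (i, j) ∈ A' → (i, j') ∈ A' → (i, j) ∈ A) (t : ℕ) :
    entryMinors x A' (t + 1) ≤ entryMinors x A t := by
  refine entryMinors_le fun r c hr hc hm => ?_
  rw [Matrix.det_succ_column _ 0]
  refine Ideal.sum_mem _ fun j _ => Ideal.mul_mem_left _ _ (Ideal.subset_span
    ⟨r ∘ j.succAbove, c ∘ Fin.succ, hr.comp (Fin.strictMono_succAbove j),
      hc.comp Fin.strictMono_succ, fun p q => ?_, ?_⟩)
  · exact h _ _ _ (hc (Fin.succ_pos q)) (hm _ _) (hm _ 0)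
  · simp only [Fin.succAbove_zero]
    rfl

section Border

variable {ι R : Type*} [Fintype ι] [DecidableEq ι] [CommRing R]

/-- The minor of `x` with rows `r` and columns `c`. -/
def rowColMinor (x : ℕ × ℕ → R) (r c : ι → ℕ) : R := (Matrix.of fun p q => x (r p, c q)).det

/-- The part of the minor with rows `r` and `i` and columns `c` and `j` that does not involve
the entry `x (i, j)`. -/
def borderMinor (x : ℕ × ℕ → R) (r c : ι → ℕ) (i j : ℕ) : R :=
  -((Matrix.of fun (_ : Unit) q => x (i, c q)) * (Matrix.of fun p q => x (r p, c q)).adjugate *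
    (Matrix.of fun p (_ : Unit) => x (r p, j))) () ()

theorem rowColMinor_sumElim (x : ℕ × ℕ → R) (r c : ι → ℕ) (i j : ℕ) :
    rowColMinor x (Sum.elim r fun _ : Unit => i) (Sum.elim c fun _ : Unit => j) =
      x (i, j) * rowColMinor x r c + borderMinor x r c i j := by
  have h := Matrix.det_fromBlocks_unit (Matrix.of fun p q => x (r p, c q))
    (Matrix.of fun p (_ : Unit) => x (r p, j)) (Matrix.of fun (_ : Unit) q => x (i, c q))
    (Matrix.of fun (_ _ : Unit) => x (i, j))
  rw [borderMinor, rowColMinor, rowColMinor, ← sub_eq_add_neg]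
  refine Eq.trans ?_ h
  congr 1
  ext (p | p) (q | q) <;> rfl

theorem map_rowColMinor {S : Type*} [CommRing S] (φ : R →+* S) (x : ℕ × ℕ → R) (r c : ι → ℕ) :
    φ (rowColMinor x r c) = rowColMinor (φ ∘ x) r c := by
  rw [rowColMinor, RingHom.map_det]
  rfl

theorem map_borderMinor {S : Type*} [CommRing S] (φ : R →+* S) (x : ℕ × ℕ → R) (r c : ι → ℕ)
    (i j : ℕ) : φ (borderMinor x r c i j) = borderMinor (φ ∘ x) r c i j := by
  have h := congrArg φ (rowColMinor_sumElim x r c i j)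
  rw [map_add, map_mul, map_rowColMinor, map_rowColMinor, rowColMinor_sumElim] at h
  exact (add_left_cancel h).symm

theorem borderMinor_congr {x x' : ℕ × ℕ → R} {r c : ι → ℕ} {i j : ℕ}
    (h₁ : ∀ p q, x (r p, c q) = x' (r p, c q)) (h₂ : ∀ q, x (i, c q) = x' (i, c q))
    (h₃ : ∀ p, x (r p, j) = x' (r p, j)) : borderMinor x r c i j = borderMinor x' r c i j := by
  simp only [borderMinor, h₁, h₂, h₃]

theorem rowColMinor_mul_borderMinor_sub_mem (N : Ideal R) (x : ℕ × ℕ → R) (r c r₀ c₀ : ι → ℕ)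
    (i j : ℕ)
    (h₁ : ∀ k, rowColMinor x (Sum.elim r fun _ : Unit => r₀ k) (Sum.elim c fun _ : Unit => j) ∈ N)
    (h₂ : ∀ l, rowColMinor x (Sum.elim r₀ fun _ : Unit => i)
      (Sum.elim c₀ fun _ : Unit => c l) ∈ N) :
    rowColMinor x r c * borderMinor x r₀ c₀ i j - rowColMinor x r₀ c₀ * borderMinor x r c i j ∈
      N := by
  simp only [← Ideal.Quotient.eq_zero_iff_mem, map_rowColMinor, map_sub,
    map_mul, map_borderMinor] at h₁ h₂ ⊢
  generalize (Ideal.Quotient.mk N : R → R ⧸ N) ∘ x = x at h₁ h₂ ⊢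
  simp only [rowColMinor_sumElim] at h₁ h₂
  have h := Matrix.det_mul_schur_eq (Matrix.of fun p q => x (r p, c q))
    (Matrix.of fun p q => x (r₀ p, c₀ q)) (Matrix.of fun p q => x (r₀ p, c q))
    (Matrix.of fun p (_ : Unit) => x (r p, j)) (Matrix.of fun p (_ : Unit) => x (r₀ p, j))
    (Matrix.of fun (_ : Unit) q => x (i, c q)) (Matrix.of fun (_ : Unit) q => x (i, c₀ q)) ?_ ?_
  · simp only [rowColMinor, borderMinor]
    linear_combination -h
  · ext k s
    have := h₁ k
    rw [borderMinor, ← sub_eq_add_neg, sub_eq_zero] at this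
    rw [Matrix.smul_apply, smul_eq_mul, mul_comm]
    exact this
  · ext s l
    have := h₂ l
    rw [borderMinor, ← sub_eq_add_neg, sub_eq_zero] at this
    rw [Matrix.smul_apply, smul_eq_mul, mul_comm]
    refine this.trans ?_
    simp only [Matrix.mul_assoc]
    rfl

end Border

/-- The entries of `U` strictly above row `s.1` and weakly right of column `s.2.1`. A triple
`s = (d, c, t)` stands for the `t × t` minors of this region. -/
def cornerRegion (U : Set (ℕ × ℕ)) (s : ℕ × ℕ × ℕ) : Set (ℕ × ℕ) :=
  {p | p ∈ U ∧ p.1 < s.1 ∧ s.2.1 ≤ p.2}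

/-- The mixed ladder determinantal ideal of the matrix `x` for the one-sided ladder `U`
and the corners `S`. -/
def cornerIdeal {R : Type*} [CommRing R] (x : ℕ × ℕ → R) (U : Set (ℕ × ℕ))
    (S : Finset (ℕ × ℕ × ℕ)) : Ideal R :=
  ⨆ s ∈ S, entryMinors x (cornerRegion U s) s.2.2

/-- Closed under moving down and left in the matrix. -/
def IsOneSidedLadder (U : Set (ℕ × ℕ)) : Prop :=
  ∀ ⦃i j i' j' : ℕ⦄, (i, j) ∈ U → i ≤ i' → j' ≤ j → (i', j') ∈ U

/-- The order on corners prescribed by the standing assumptions on mixed ladders. -/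
def CornerLT (s s' : ℕ × ℕ × ℕ) : Prop :=
  s.1 ≤ s'.1 ∧ s.2.1 ≤ s'.2.1 ∧ s.1 + s'.2.2 < s'.1 + s.2.2 ∧ s.2.1 + s.2.2 < s'.2.1 + s'.2.2

/-- Any two corners are comparable, and all minors have positive size. -/
def IsCornerChain (S : Finset (ℕ × ℕ × ℕ)) : Prop :=
  (∀ s ∈ S, ∀ s' ∈ S, s ≠ s' → CornerLT s s' ∨ CornerLT s' s) ∧ ∀ s ∈ S, 1 ≤ s.2.2

/-- The upper right entries of the minors; their number is the height of `cornerIdeal`. -/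
def cornerHeightSet (U : Set (ℕ × ℕ)) (S : Finset (ℕ × ℕ × ℕ)) : Set (ℕ × ℕ) :=
  {p | p ∈ U ∧ ∃ s ∈ S, p.1 + s.2.2 ≤ s.1 ∧ s.2.1 + s.2.2 ≤ p.2 + 1}

/-- All entries that occur in some region. -/
def cornerSupport (U : Set (ℕ × ℕ)) (S : Finset (ℕ × ℕ × ℕ)) : Set (ℕ × ℕ) :=
  ⋃ s ∈ S, cornerRegion U s

section CornerIdeal

variable {R : Type*} [CommRing R] (x : ℕ × ℕ → R) (U : Set (ℕ × ℕ))

theorem entryMinors_le_cornerIdeal {S : Finset (ℕ × ℕ × ℕ)} {s : ℕ × ℕ × ℕ} (hs : s ∈ S) :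
    entryMinors x (cornerRegion U s) s.2.2 ≤ cornerIdeal x U S :=
  le_iSup₂_of_le s hs le_rfl

theorem cornerIdeal_mono {S S' : Finset (ℕ × ℕ × ℕ)} (h : S ⊆ S') :
    cornerIdeal x U S ≤ cornerIdeal x U S' :=
  iSup₂_le fun _ hs => entryMinors_le_cornerIdeal x U (h hs)

theorem cornerIdeal_insert (s : ℕ × ℕ × ℕ) (S : Finset (ℕ × ℕ × ℕ)) :
    cornerIdeal x U (insert s S) =
      entryMinors x (cornerRegion U s) s.2.2 ⊔ cornerIdeal x U S := by
  simp only [cornerIdeal, Finset.iSup_insert]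

theorem map_cornerIdeal {R' : Type*} [CommRing R'] (φ : R →+* R') (S : Finset (ℕ × ℕ × ℕ)) :
    (cornerIdeal x U S).map φ = cornerIdeal (φ ∘ x) U S := by
  simp only [cornerIdeal, Ideal.map_iSup, map_entryMinors]

theorem cornerIdeal_congr {x x' : ℕ × ℕ → R} {U : Set (ℕ × ℕ)} {S : Finset (ℕ × ℕ × ℕ)}
    (h : ∀ p ∈ cornerSupport U S, x p = x' p) : cornerIdeal x U S = cornerIdeal x' U S := by
  refine iSup_congr fun s => iSup_congr fun hs => entryMinors_congr (fun p hp => h p ?_) _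
  exact Set.mem_biUnion hs hp

theorem cornerRegion_mono {d d' c c' t t' : ℕ} (hd : d ≤ d') (hc : c' ≤ c) :
    cornerRegion U (d, c, t) ⊆ cornerRegion U (d', c', t') :=
  fun _ hp => ⟨hp.1, hp.2.1.trans_le hd, hc.trans hp.2.2⟩

theorem entryMinors_region_add_rows (d c t₀ t k : ℕ) :
    entryMinors x (cornerRegion U (d + k, c, t₀)) (t + k) ≤
      entryMinors x (cornerRegion U (d, c, t₀)) t := by
  induction k with
  | zero => exact le_rfl
  | succ k ih =>
    refine le_trans (entryMinors_succ_le_of_rows x (fun i i' j hi h h' => ?_) (t + k)) ih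
    exact ⟨h.1, by have := h'.2.1; simp only at this ⊢; omega, h.2.2⟩

theorem entryMinors_region_add_columns (d c t₀ t k : ℕ) :
    entryMinors x (cornerRegion U (d, c, t₀)) (t + k) ≤
      entryMinors x (cornerRegion U (d, c + k, t₀)) t := by
  induction k generalizing t with
  | zero => exact le_rfl
  | succ k ih =>
    rw [add_comm k 1, ← add_assoc, add_comm 1 k]
    refine (ih (t + 1)).trans (entryMinors_succ_le_of_columns x (fun i j j' hj h h' => ?_) t)
    exact ⟨h.1, h.2.1, by have := h'.2.2; simp only at this ⊢; omega⟩

end CornerIdeal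

section Step

/-- The position of the corner `(b + τ + 1, c, τ + 1)` with respect to the other corners `S` when
it has the smallest column and, among those corners, the largest row. -/
def IsFirstCorner (S : Finset (ℕ × ℕ × ℕ)) (b c τ : ℕ) : Prop :=
  ∀ s ∈ S, 1 ≤ s.2.2 ∧ ((s.2.1 = c ∧ s.1 < b + s.2.2 ∧ s.2.2 ≤ τ) ∨
    (c < s.2.1 ∧ b + τ + 1 ≤ s.1 ∧ b + s.2.2 < s.1 ∧ c + τ + 1 < s.2.1 + s.2.2))

open Classical in
/-- The corners left after the corner `(b + τ + 1, c, τ + 1)` is shrunk by its last row, and by its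
first column. -/
noncomputable def shrinkCorner (S : Finset (ℕ × ℕ × ℕ)) (b c τ : ℕ) : Finset (ℕ × ℕ × ℕ) :=
  S ∪ ({(b + τ, c, τ + 1), (b + τ + 1, c + 1, τ + 1)} : Finset (ℕ × ℕ × ℕ)).filter
    fun z => ∀ s ∈ S, CornerLT s z ∨ CornerLT z s

theorem mem_shrinkCorner {S : Finset (ℕ × ℕ × ℕ)} {b c τ : ℕ} {z : ℕ × ℕ × ℕ} :
    z ∈ shrinkCorner S b c τ ↔ z ∈ S ∨ ((z = (b + τ, c, τ + 1) ∨ z = (b + τ + 1, c + 1, τ + 1)) ∧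
      ∀ s ∈ S, CornerLT s z ∨ CornerLT z s) := by
  simp [shrinkCorner]

/-- The corner `(b + τ + 1, c, τ + 1)` replaced by the corner `(b + τ, c + 1, τ)`. -/
def dropCorner (S : Finset (ℕ × ℕ × ℕ)) (b c τ : ℕ) : Finset (ℕ × ℕ × ℕ) :=
  insert (b + τ, c + 1, τ) S

variable {S : Finset (ℕ × ℕ × ℕ)} {b c τ : ℕ}

theorem IsCornerChain.exists_isFirstCorner (hS : IsCornerChain S) (hne : S.Nonempty) :
    ∃ s ∈ S, ∀ s' ∈ S.erase s, 1 ≤ s'.2.2 ∧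
      ((s'.2.1 = s.2.1 ∧ s'.1 + s.2.2 < s.1 + s'.2.2 ∧ s'.2.2 < s.2.2) ∨
      (s.2.1 < s'.2.1 ∧ s.1 ≤ s'.1 ∧ s.1 + s'.2.2 < s'.1 + s.2.2 ∧
        s.2.1 + s.2.2 < s'.2.1 + s'.2.2)) := by
  obtain ⟨s₁, hs₁, hmin⟩ := S.exists_min_image (fun s => s.2.1) hne
  obtain ⟨s, hs, hmax⟩ := (S.filter fun s => s.2.1 = s₁.2.1).exists_max_image (fun s => s.1)
    ⟨s₁, by simp [hs₁]⟩
  rw [Finset.mem_filter] at hs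
  refine ⟨s, hs.1, fun s' hs' => ⟨hS.2 _ (Finset.mem_of_mem_erase hs'), ?_⟩⟩
  have h1 := hmin s' (Finset.mem_of_mem_erase hs')
  have h2 := hmax s'
  rw [Finset.mem_filter] at h2
  have h3 := hS.1 s hs.1 s' (Finset.mem_of_mem_erase hs') (Finset.ne_of_mem_erase hs').symm
  simp only [CornerLT] at h3
  by_cases hc : s'.2.1 = s₁.2.1
  · have := h2 ⟨Finset.mem_of_mem_erase hs', hc⟩
    omega
  · omega

theorem IsCornerChain.erase (hS : IsCornerChain S) (s : ℕ × ℕ × ℕ) : IsCornerChain (S.erase s) :=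
  ⟨fun _ h _ h' => hS.1 _ (Finset.mem_of_mem_erase h) _ (Finset.mem_of_mem_erase h'),
    fun _ h => hS.2 _ (Finset.mem_of_mem_erase h)⟩

theorem isCornerChain_shrinkCorner (hS : IsCornerChain S) :
    IsCornerChain (shrinkCorner S b c τ) := by
  refine ⟨fun s hs s' hs' hne => ?_, fun s hs => ?_⟩
  · rw [mem_shrinkCorner] at hs hs'
    rcases hs with hs | ⟨hs, h⟩ <;> rcases hs' with hs' | ⟨hs', h'⟩
    · exact hS.1 s hs s' hs' hne
    · exact h' s hs
    · exact (h s' hs').symm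
    · rcases hs with rfl | rfl <;> rcases hs' with rfl | rfl
      · exact absurd rfl hne
      · left; simp only [CornerLT]; omega
      · right; simp only [CornerLT]; omega
      · exact absurd rfl hne
  · rw [mem_shrinkCorner] at hs
    rcases hs with hs | ⟨rfl | rfl, h⟩
    · exact hS.2 s hs
    · simp
    · simp

theorem isCornerChain_dropCorner (hS : IsCornerChain S) (h : IsFirstCorner S b c τ) (hτ : 1 ≤ τ) :
    IsCornerChain (dropCorner S b c τ) := by
  have key : ∀ s ∈ S, CornerLT s (b + τ, c + 1, τ) ∨ CornerLT (b + τ, c + 1, τ) s := by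
    intro s hs
    have := h s hs
    simp only [CornerLT]
    omega
  refine ⟨fun s hs s' hs' hne => ?_, fun s hs => ?_⟩
  · rw [dropCorner, Finset.mem_insert] at hs hs'
    rcases hs with rfl | hs <;> rcases hs' with rfl | hs'
    · exact absurd rfl hne
    · exact (key _ hs').symm
    · exact key _ hs
    · exact hS.1 s hs s' hs' hne
  · rw [dropCorner, Finset.mem_insert] at hs
    rcases hs with rfl | hs
    · exact hτ
    · exact hS.2 s hs

theorem mem_shrinkCorner_left_or (h : IsFirstCorner S b c τ) :
    (b + τ, c, τ + 1) ∈ shrinkCorner S b c τ ∨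
      ∃ s ∈ S, s.2.1 = c ∧ s.1 + 1 = b + s.2.2 ∧ s.2.2 ≤ τ := by
  by_cases hh : ∀ s ∈ S, CornerLT s (b + τ, c, τ + 1) ∨ CornerLT (b + τ, c, τ + 1) s
  · exact Or.inl (mem_shrinkCorner.2 (Or.inr ⟨Or.inl rfl, hh⟩))
  · push Not at hh
    obtain ⟨s, hs, h1, h2⟩ := hh
    refine Or.inr ⟨s, hs, ?_⟩
    have := h s hs
    simp only [CornerLT] at h1 h2
    omega

theorem mem_shrinkCorner_right_or (h : IsFirstCorner S b c τ) :
    (b + τ + 1, c + 1, τ + 1) ∈ shrinkCorner S b c τ ∨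
      ∃ s ∈ S, c < s.2.1 ∧ b + τ + 1 ≤ s.1 ∧ b + s.2.2 < s.1 ∧ s.2.1 + s.2.2 = c + τ + 2 := by
  by_cases hh : ∀ s ∈ S, CornerLT s (b + τ + 1, c + 1, τ + 1) ∨ CornerLT (b + τ + 1, c + 1, τ + 1) s
  · exact Or.inl (mem_shrinkCorner.2 (Or.inr ⟨Or.inr rfl, hh⟩))
  · push Not at hh
    obtain ⟨s, hs, h1, h2⟩ := hh
    refine Or.inr ⟨s, hs, ?_⟩
    have := h s hs
    simp only [CornerLT] at h1 h2
    omega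

theorem subset_shrinkCorner : S ⊆ shrinkCorner S b c τ :=
  fun _ hs => mem_shrinkCorner.2 (Or.inl hs)

theorem card_shrinkCorner_le : (shrinkCorner S b c τ).card ≤ S.card + 2 := by
  classical
  refine (Finset.card_union_le _ _).trans (Nat.add_le_add_left ?_ _)
  exact (Finset.card_filter_le _ _).trans Finset.card_le_two

variable (U : Set (ℕ × ℕ))

theorem cornerHeightSet_insert (h : IsFirstCorner S b c τ) (hp : (b, c + τ) ∈ U) :
    cornerHeightSet U (insert (b + τ + 1, c, τ + 1) S) =
      insert (b, c + τ) (cornerHeightSet U (shrinkCorner S b c τ)) := by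
  ext p
  simp only [cornerHeightSet, Set.mem_insert_iff, Set.mem_ofPred_eq]
  constructor
  · rintro ⟨hpU, s, hs, h1, h2⟩
    rw [Finset.mem_insert] at hs
    rcases hs with rfl | hs
    · simp only at h1 h2
      by_cases hb : p.1 < b
      · rcases mem_shrinkCorner_left_or h with hm | ⟨s, hs, hm⟩
        · exact Or.inr ⟨hpU, _, hm, by simp only; omega, by simp only; omega⟩
        · exact Or.inr ⟨hpU, s, subset_shrinkCorner hs, by omega, by omega⟩
      by_cases hc : c + τ < p.2
      · rcases mem_shrinkCorner_right_or h with hm | ⟨s, hs, hm⟩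
        · exact Or.inr ⟨hpU, _, hm, by simp only; omega, by simp only; omega⟩
        · exact Or.inr ⟨hpU, s, subset_shrinkCorner hs, by omega, by omega⟩
      · exact Or.inl (Prod.ext (by simp only; omega) (by simp only; omega))
    · exact Or.inr ⟨hpU, s, subset_shrinkCorner hs, h1, h2⟩
  · rintro (rfl | ⟨hpU, s, hs, h1, h2⟩)
    · exact ⟨hp, _, Finset.mem_insert_self _ _, by simp only; omega, by simp only; omega⟩
    · rw [mem_shrinkCorner] at hs
      rcases hs with hs | ⟨rfl | rfl, -⟩
      · exact ⟨hpU, s, Finset.mem_insert_of_mem hs, h1, h2⟩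
      · simp only at h1 h2
        exact ⟨hpU, _, Finset.mem_insert_self _ _, by simp only; omega, by simp only; omega⟩
      · simp only at h1 h2
        exact ⟨hpU, _, Finset.mem_insert_self _ _, by simp only; omega, by simp only; omega⟩

theorem notMem_cornerHeightSet_shrinkCorner (h : IsFirstCorner S b c τ) :
    (b, c + τ) ∉ cornerHeightSet U (shrinkCorner S b c τ) := by
  rintro ⟨-, s, hs, h1, h2⟩
  rw [mem_shrinkCorner] at hs
  simp only at h1 h2
  rcases hs with hs | ⟨rfl | rfl, -⟩
  · have := h s hs
    omega
  · simp only at h1 h2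
    omega
  · simp only at h1 h2
    omega

theorem cornerHeightSet_dropCorner :
    cornerHeightSet U (dropCorner S b c τ) =
      cornerHeightSet U (insert (b + τ + 1, c, τ + 1) S) := by
  ext p
  simp only [cornerHeightSet, dropCorner, Set.mem_ofPred_eq, Finset.exists_mem_insert]
  refine and_congr_right fun _ => or_congr ?_ Iff.rfl
  constructor <;> rintro ⟨h1, h2⟩ <;> constructor <;> omega

theorem cornerSupport_insert (s : ℕ × ℕ × ℕ) :
    cornerSupport U (insert s S) = cornerRegion U s ∪ cornerSupport U S :=
  Finset.set_biUnion_insert _ _ _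

theorem notMem_cornerSupport (h : IsFirstCorner S b c τ) : (b + τ, c) ∉ cornerSupport U S := by
  simp only [cornerSupport, Set.mem_iUnion, not_exists]
  intro s hs hy
  have h1 := hy.2
  have := h s hs
  simp only at h1
  omega

theorem cornerSupport_shrinkCorner_subset (h : IsFirstCorner S b c τ) :
    cornerSupport U (shrinkCorner S b c τ) ⊆
      cornerSupport U (insert (b + τ + 1, c, τ + 1) S) \ {(b + τ, c)} := by
  intro p hp
  rw [cornerSupport_insert]
  simp only [cornerSupport, Set.mem_iUnion] at hp
  obtain ⟨s, hs, hp⟩ := hp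
  rw [mem_shrinkCorner] at hs
  rcases hs with hs | ⟨rfl | rfl, -⟩
  · have hm : p ∈ cornerSupport U S := Set.mem_biUnion hs hp
    refine ⟨Or.inr hm, ?_⟩
    rintro rfl
    exact notMem_cornerSupport U h hm
  · refine ⟨Or.inl (cornerRegion_mono U (by omega) le_rfl hp), ?_⟩
    rintro rfl
    exact lt_irrefl _ hp.2.1
  · refine ⟨Or.inl (cornerRegion_mono U le_rfl (by omega) hp), ?_⟩
    rintro rfl
    exact Nat.not_succ_le_self _ hp.2.2

theorem cornerSupport_dropCorner_subset (h : IsFirstCorner S b c τ) :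
    cornerSupport U (dropCorner S b c τ) ⊆
      cornerSupport U (insert (b + τ + 1, c, τ + 1) S) \ {(b + τ, c)} := by
  intro p hp
  rw [dropCorner, cornerSupport_insert] at hp
  rw [cornerSupport_insert]
  rcases hp with hp | hm
  · refine ⟨Or.inl (cornerRegion_mono U (by omega) (by omega) hp), ?_⟩
    rintro rfl
    exact lt_irrefl _ hp.2.1
  · refine ⟨Or.inr hm, ?_⟩
    rintro rfl
    exact notMem_cornerSupport U h hm

end Step

theorem Matrix.det_submatrix_equiv_equiv {ι κ R : Type*} [Fintype ι] [DecidableEq ι] [Fintype κ]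
    [DecidableEq κ] [CommRing R] (e₁ e₂ : κ ≃ ι) (M : Matrix ι ι R) :
    ∃ u : ℤˣ, (M.submatrix e₁ e₂).det = ((u : ℤ) : R) * M.det := by
  refine ⟨Equiv.Perm.sign (e₁.symm.trans e₂), ?_⟩
  have h : M.submatrix e₁ e₂ = (M.submatrix id (e₁.symm.trans e₂)).submatrix e₁ e₁ := by
    ext i j
    simp
  rw [h, Matrix.det_submatrix_equiv_self, Matrix.det_permute']

theorem Matrix.det_mem_of_det_submatrix_mem {ι κ R : Type*} [Fintype ι] [DecidableEq ι] [Fintype κ]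
    [DecidableEq κ] [CommRing R] {I : Ideal R} (e₁ e₂ : κ ≃ ι) {M : Matrix ι ι R}
    (h : (M.submatrix e₁ e₂).det ∈ I) : M.det ∈ I := by
  obtain ⟨u, hu⟩ := Matrix.det_submatrix_equiv_equiv e₁ e₂ M
  rw [hu] at h
  have := I.mul_mem_left ((u : ℤ) : R) h
  rwa [← mul_assoc, ← Int.cast_mul, ← Units.val_mul, Int.units_mul_self, Units.val_one,
    Int.cast_one, one_mul] at this

/-- The rows and columns of the `τ × τ` minors of the region of the corner `(b + τ, c + 1, τ)`. -/
abbrev DropIndex (U : Set (ℕ × ℕ)) (b c τ : ℕ) : Type :=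
  {k : (Fin τ → ℕ) × (Fin τ → ℕ) // StrictMono k.1 ∧ StrictMono k.2 ∧
    ∀ p q, (k.1 p, k.2 q) ∈ cornerRegion U (b + τ, c + 1, τ)}

section

variable {R : Type*} [CommRing R] (x : ℕ × ℕ → R) {U : Set (ℕ × ℕ)} {b c τ : ℕ}

/-- The minor with the given rows and columns. -/
def dropMinor (k : DropIndex U b c τ) : R := rowColMinor x k.1.1 k.1.2

/-- The part not involving `x (b + τ, c)` of the minor bordered by row `b + τ` and column `c`. -/
def dropBorder (k : DropIndex U b c τ) : R := borderMinor x k.1.1 k.1.2 (b + τ) c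

/-- The minor bordered by row `b + τ` and column `c`, up to a sign. -/
def dropFull (k : DropIndex U b c τ) : R := x (b + τ, c) * dropMinor x k + dropBorder x k

theorem span_range_dropMinor :
    Ideal.span (Set.range (dropMinor x : DropIndex U b c τ → R)) =
      entryMinors x (cornerRegion U (b + τ, c + 1, τ)) τ := by
  rw [entryMinors]
  congr 1
  ext f
  constructor
  · rintro ⟨⟨⟨r, cc⟩, hr, hc, hm⟩, rfl⟩
    exact ⟨r, cc, hr, hc, hm, rfl⟩
  · rintro ⟨r, cc, hr, hc, hm, rfl⟩
    exact ⟨⟨⟨r, cc⟩, hr, hc, hm⟩, rfl⟩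

theorem map_dropMinor {R' : Type*} [CommRing R'] (φ : R →+* R') (k : DropIndex U b c τ) :
    φ (dropMinor x k) = dropMinor (φ ∘ x) k :=
  map_rowColMinor φ x _ _

theorem map_dropBorder {R' : Type*} [CommRing R'] (φ : R →+* R') (k : DropIndex U b c τ) :
    φ (dropBorder x k) = dropBorder (φ ∘ x) k :=
  map_borderMinor φ x _ _ _ _

theorem map_dropFull {R' : Type*} [CommRing R'] (φ : R →+* R') (k : DropIndex U b c τ) :
    φ (dropFull x k) = dropFull (φ ∘ x) k := by
  simp only [dropFull, map_add, map_mul, map_dropMinor, map_dropBorder, Function.comp_apply]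

theorem dropFull_eq (k : DropIndex U b c τ) : dropFull x k =
    rowColMinor x (Sum.elim k.1.1 fun _ : Unit => b + τ) (Sum.elim k.1.2 fun _ : Unit => c) :=
  (rowColMinor_sumElim x _ _ _ _).symm

variable {S : Finset (ℕ × ℕ × ℕ)}

theorem cornerIdeal_shrinkCorner_sup_dropMinor :
    cornerIdeal x U (shrinkCorner S b c τ) ⊔
        Ideal.span (Set.range (dropMinor x : DropIndex U b c τ → R)) =
      cornerIdeal x U (dropCorner S b c τ) := by
  rw [span_range_dropMinor, dropCorner, cornerIdeal_insert]
  refine le_antisymm (sup_le (iSup₂_le fun s hs => ?_) le_sup_left)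
    (sup_le le_sup_right (le_sup_of_le_left (cornerIdeal_mono x U subset_shrinkCorner)))
  rw [mem_shrinkCorner] at hs
  rcases hs with hs | ⟨rfl | rfl, -⟩
  · exact le_sup_of_le_right (entryMinors_le_cornerIdeal x U hs)
  · exact le_sup_of_le_left (entryMinors_region_add_columns x U (b + τ) c _ τ 1)
  · exact le_sup_of_le_left (entryMinors_region_add_rows x U (b + τ) (c + 1) _ τ 1)

theorem entryMinors_left_le (h : IsFirstCorner S b c τ) (t₀ : ℕ) :
    entryMinors x (cornerRegion U (b + τ, c, t₀)) (τ + 1) ≤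
      cornerIdeal x U (shrinkCorner S b c τ) := by
  rcases mem_shrinkCorner_left_or h with hm | ⟨⟨d', c', t'⟩, hs, h1, h2, h3⟩
  · exact (entryMinors_mono x (cornerRegion_mono U le_rfl le_rfl) _).trans
      (entryMinors_le_cornerIdeal x U hm)
  · simp only at h1 h2 h3
    refine le_trans ?_ (entryMinors_le_cornerIdeal x U (subset_shrinkCorner hs))
    have := entryMinors_region_add_rows x U d' c' t' t' (τ + 1 - t')
    rw [show d' + (τ + 1 - t') = b + τ by omega, show t' + (τ + 1 - t') = τ + 1 by omega] at this
    subst h1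
    exact (entryMinors_mono x (cornerRegion_mono U le_rfl le_rfl) _).trans this

theorem entryMinors_right_le (h : IsFirstCorner S b c τ) (t₀ : ℕ) :
    entryMinors x (cornerRegion U (b + τ + 1, c + 1, t₀)) (τ + 1) ≤
      cornerIdeal x U (shrinkCorner S b c τ) := by
  rcases mem_shrinkCorner_right_or h with hm | ⟨⟨d', c', t'⟩, hs, h1, h2, h3, h4⟩
  · exact (entryMinors_mono x (cornerRegion_mono U le_rfl le_rfl) _).trans
      (entryMinors_le_cornerIdeal x U hm)
  · simp only at h1 h2 h3 h4
    refine le_trans ?_ (entryMinors_le_cornerIdeal x U (subset_shrinkCorner hs))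
    have := entryMinors_region_add_columns x U (b + τ + 1) (c + 1) t' t' (τ + 1 - t')
    rw [show c + 1 + (τ + 1 - t') = c' by omega, show t' + (τ + 1 - t') = τ + 1 by omega] at this
    exact this.trans (entryMinors_mono x (cornerRegion_mono U h2 le_rfl) _)

theorem cornerIdeal_insert_eq (hU : IsOneSidedLadder U) (h : IsFirstCorner S b c τ)
    (hp : (b, c + τ) ∈ U) :
    cornerIdeal x U (insert (b + τ + 1, c, τ + 1) S) =
      cornerIdeal x U (shrinkCorner S b c τ) ⊔
        Ideal.span (Set.range (dropFull x : DropIndex U b c τ → R)) := by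
  rw [cornerIdeal_insert]
  refine le_antisymm (sup_le (entryMinors_le fun r cc hr hc hm => ?_)
    (le_sup_of_le_left (cornerIdeal_mono x U subset_shrinkCorner)))
    (sup_le (iSup₂_le fun s hs => ?_) (Ideal.span_le.2 ?_))
  · by_cases h1 : r (Fin.last τ) < b + τ
    · refine Ideal.mem_sup_left (entryMinors_left_le x h 0 (Ideal.subset_span
        ⟨r, cc, hr, hc, fun p q => ⟨(hm p q).1, ?_, (hm p q).2.2⟩, rfl⟩))
      exact (hr.monotone (Fin.le_last p)).trans_lt h1
    by_cases h2 : c < cc 0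
    · refine Ideal.mem_sup_left (entryMinors_right_le x h 0 (Ideal.subset_span
        ⟨r, cc, hr, hc, fun p q => ⟨(hm p q).1, (hm p q).2.1, ?_⟩, rfl⟩))
      exact Nat.succ_le_of_lt (h2.trans_le (hc.monotone (Fin.zero_le q)))
    have hl := hm (Fin.last τ) 0
    have h3 : r (Fin.last τ) = b + τ := by
      have := hl.2.1
      simp only at this
      omega
    have h4 : cc 0 = c := by
      have := hl.2.2
      simp only at this
      omega
    refine Ideal.mem_sup_right ?_
    let k : DropIndex U b c τ := ⟨⟨r ∘ Fin.castSucc, cc ∘ Fin.succ⟩,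
      hr.comp Fin.strictMono_castSucc, hc.comp Fin.strictMono_succ,
      fun p q => ⟨(hm _ _).1, h3 ▸ hr (Fin.castSucc_lt_last p),
        Nat.succ_le_of_lt (h4 ▸ hc (Fin.succ_pos q))⟩⟩
    have hk : dropFull x k ∈ Ideal.span (Set.range (dropFull x : DropIndex U b c τ → R)) :=
      Ideal.subset_span ⟨k, rfl⟩
    rw [dropFull_eq] at hk
    refine Matrix.det_mem_of_det_submatrix_mem
      (finSuccEquivLast.trans (Equiv.optionEquivSumPUnit.{0} _)).symm
      ((finSuccEquiv τ).trans (Equiv.optionEquivSumPUnit.{0} _)).symm ?_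
    convert hk using 1
    rw [rowColMinor]
    congr 1
    ext (p | p) (q | q) <;> simp [k, h3, h4]
  · rw [mem_shrinkCorner] at hs
    rcases hs with hs | ⟨rfl | rfl, -⟩
    · exact le_sup_of_le_right (entryMinors_le_cornerIdeal x U hs)
    · exact le_sup_of_le_left (entryMinors_mono x (cornerRegion_mono U (by omega) le_rfl) _)
    · exact le_sup_of_le_left (entryMinors_mono x (cornerRegion_mono U le_rfl (by omega)) _)
  · rintro _ ⟨k, rfl⟩
    rw [dropFull_eq]
    refine Ideal.mem_sup_left ?_
    have := det_mem_entryMinors x (cornerRegion U (b + τ + 1, c, τ + 1))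
      (Sum.elim k.1.1 fun _ : Unit => b + τ) (Sum.elim k.1.2 fun _ : Unit => c) ?_
    · rwa [Fintype.card_sum, Fintype.card_fin, Fintype.card_unit] at this
    · have hk := k.2.2.2
      simp only [cornerRegion, Set.mem_ofPred_eq] at hk ⊢
      rintro (p | p) (q | q)
      · have := hk p q
        exact ⟨this.1, by simp only [Sum.elim_inl]; omega, by simp only [Sum.elim_inl]; omega⟩
      · have := hk p p
        exact ⟨hU this.1 le_rfl (by simp only [Sum.elim_inr]; omega),
          by simp only [Sum.elim_inl]; omega, by simp only [Sum.elim_inr]; omega⟩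
      · have := hk q q
        exact ⟨hU this.1 (by simp only [Sum.elim_inr]; omega) le_rfl,
          by simp only [Sum.elim_inr]; omega, by simp only [Sum.elim_inl]; omega⟩
      · exact ⟨hU hp (by simp only [Sum.elim_inr]; omega) (by simp only [Sum.elim_inr]; omega),
          by simp only [Sum.elim_inr]; omega, by simp only [Sum.elim_inr]; omega⟩

theorem StrictMono.add_sub_le_of_fin {t : ℕ} {r : Fin t → ℕ} (hr : StrictMono r) {i j : Fin t}
    (h : i ≤ j) : r i + (j - i : ℕ) ≤ r j := by
  obtain ⟨j, hj⟩ := j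
  induction j with
  | zero =>
    have : i = ⟨0, hj⟩ := le_antisymm h (Nat.zero_le _)
    subst this
    simp
  | succ j ih =>
    rcases eq_or_lt_of_le h with rfl | h'
    · simp
    · have h1 := ih (by omega) (Nat.le_of_lt_succ h')
      have h2 : r ⟨j, by omega⟩ < r ⟨j + 1, hj⟩ := hr (by simp [Fin.lt_def])
      have h3 : (i : ℕ) < j + 1 := h'
      simp only at h1 ⊢
      omega

/-- The block of rows `b, …, b + τ - 1` and columns `c + 1, …, c + τ`. -/
def baseIndex (hU : IsOneSidedLadder U) (hp : (b, c + τ) ∈ U) : DropIndex U b c τ :=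
  ⟨⟨fun k => b + k, fun l => c + 1 + l⟩, fun i j hij => Nat.add_lt_add_left hij _,
    fun i j hij => Nat.add_lt_add_left hij _,
    fun p q => ⟨hU hp (by simp) (by have := q.2; simp only; omega),
      by have := p.2; simp only; omega, by simp only; omega⟩⟩

theorem dropMinor_mul_dropBorder_sub_mem (hU : IsOneSidedLadder U) (h : IsFirstCorner S b c τ)
    (hp : (b, c + τ) ∈ U) (k : DropIndex U b c τ) :
    dropMinor x k * dropBorder x (baseIndex hU hp) -
        dropMinor x (baseIndex hU hp) * dropBorder x k ∈
      cornerIdeal x U (shrinkCorner S b c τ) := by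
  obtain ⟨⟨r, cc⟩, hr, hc, hm⟩ := k
  simp only [cornerRegion, Set.mem_ofPred_eq] at hr hc hm
  have hrb : ∀ p : Fin τ, r p ≤ b + p := by
    intro p
    have hpos := p.pos
    have h1 := hr.add_sub_le_of_fin (i := p) (j := ⟨τ - 1, by omega⟩)
      (by rw [Fin.le_def]; have := p.2; simp only; omega)
    have h2 := (hm ⟨τ - 1, by omega⟩ p).2.1
    have := p.2
    simp only at h1
    omega
  refine rowColMinor_mul_borderMinor_sub_mem _ x r cc _ _ _ _ (fun k => ?_) (fun l => ?_)
  · refine entryMinors_left_le x h 0 ?_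
    have := det_mem_entryMinors x (cornerRegion U (b + τ, c, 0))
      (Sum.elim r fun _ : Unit => b + (k : ℕ)) (Sum.elim cc fun _ : Unit => c) ?_
    · rwa [Fintype.card_sum, Fintype.card_fin, Fintype.card_unit] at this
    have hk := k.2
    have hrk := hrb k
    rintro (p | p) (q | q) <;> simp only [cornerRegion, Set.mem_ofPred_eq, Sum.elim_inl,
      Sum.elim_inr]
    · have := hm p q
      exact ⟨this.1, by omega, by omega⟩
    · have := hm p p
      exact ⟨hU this.1 le_rfl (by omega), by omega, by omega⟩
    · have := hm k q
      exact ⟨hU this.1 (by omega) le_rfl, by omega, by omega⟩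
    · exact ⟨hU hp (by omega) (by omega), by omega, by omega⟩
  · refine entryMinors_right_le x h 0 ?_
    have := det_mem_entryMinors x (cornerRegion U (b + τ + 1, c + 1, 0))
      (Sum.elim (fun k : Fin τ => b + (k : ℕ)) fun _ : Unit => b + τ)
      (Sum.elim (fun l : Fin τ => c + 1 + (l : ℕ)) fun _ : Unit => cc l) ?_
    · rwa [Fintype.card_sum, Fintype.card_fin, Fintype.card_unit] at this
    rintro (p | p) (q | q) <;> simp only [cornerRegion, Set.mem_ofPred_eq, Sum.elim_inl,
      Sum.elim_inr]
    · have := p.2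
      have := q.2
      exact ⟨hU hp (by omega) (by omega), by omega, by omega⟩
    · have := hm p l
      have := hrb p
      have := p.2
      exact ⟨hU (hm p l).1 (by omega) le_rfl, by omega, by omega⟩
    · have := q.2
      exact ⟨hU hp (by omega) (by omega), by omega, by omega⟩
    · have := hm l l
      exact ⟨hU this.1 (by omega) le_rfl, by omega, by omega⟩

theorem dropFull_mul_dropMinor_sub_mem (hU : IsOneSidedLadder U) (h : IsFirstCorner S b c τ)
    (hp : (b, c + τ) ∈ U) (k : DropIndex U b c τ) :
    dropFull x (baseIndex hU hp) * dropMinor x k - dropMinor x (baseIndex hU hp) * dropFull x k ∈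
      cornerIdeal x U (shrinkCorner S b c τ) := by
  have := dropMinor_mul_dropBorder_sub_mem x hU h hp k
  convert this using 1
  simp only [dropFull]
  ring

end

theorem entryMinors_eq_bot_of_rows {R : Type*} [CommRing R] {w : ℕ × ℕ → R} {U : Set (ℕ × ℕ)}
    {b d c t t₀ : ℕ} (ht : 1 ≤ t) (h : d < b + t)
    (hw : ∀ p ∈ cornerRegion U (d, c, t₀), p.1 < b → w p = 0) :
    entryMinors w (cornerRegion U (d, c, t₀)) t = ⊥ := by
  refine le_bot_iff.1 (entryMinors_le fun r cc hr hc hm => ?_)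
  rw [Ideal.mem_bot]
  have h1 := hr.add_sub_le_of_fin (i := ⟨0, ht⟩) (j := ⟨t - 1, by omega⟩) (Nat.zero_le _)
  have h2 := (hm ⟨t - 1, by omega⟩ ⟨0, ht⟩).2.1
  simp only at h1 h2
  exact Matrix.det_eq_zero_of_row_eq_zero ⟨0, ht⟩ fun q => hw _ (hm _ _) (by simp only; omega)

theorem entryMinors_eq_bot_of_columns {R : Type*} [CommRing R] {w : ℕ × ℕ → R} {U : Set (ℕ × ℕ)}
    {e d c t t₀ : ℕ} (ht : 1 ≤ t) (h : e < c + t)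
    (hw : ∀ p ∈ cornerRegion U (d, c, t₀), e ≤ p.2 → w p = 0) :
    entryMinors w (cornerRegion U (d, c, t₀)) t = ⊥ := by
  refine le_bot_iff.1 (entryMinors_le fun r cc hr hc hm => ?_)
  rw [Ideal.mem_bot]
  have h1 := hc.add_sub_le_of_fin (i := ⟨0, ht⟩) (j := ⟨t - 1, by omega⟩) (Nat.zero_le _)
  have h2 := (hm ⟨0, ht⟩ ⟨0, ht⟩).2.2
  simp only at h1 h2
  exact Matrix.det_eq_zero_of_column_eq_zero ⟨t - 1, by omega⟩
    fun q => hw _ (hm _ _) (by simp only; omega)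

section Vanish

variable {R : Type*} [CommRing R] {w : ℕ × ℕ → R} {U : Set (ℕ × ℕ)} {S : Finset (ℕ × ℕ × ℕ)}
  {b c τ : ℕ}

theorem cornerIdeal_shrinkCorner_eq_bot (h : IsFirstCorner S b c τ)
    (hw : ∀ p, p.1 < b ∨ c + τ < p.2 → w p = 0) : cornerIdeal w U (shrinkCorner S b c τ) = ⊥ := by
  refine le_bot_iff.1 (iSup₂_le fun s hs => le_of_eq ?_)
  have hr : ∀ p ∈ cornerRegion U s, p.1 < b → w p = 0 := fun p _ hp => hw p (Or.inl hp)
  have hc : ∀ p ∈ cornerRegion U s, c + τ + 1 ≤ p.2 → w p = 0 := fun p _ hp => hw p (Or.inr hp)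
  rw [mem_shrinkCorner] at hs
  rcases hs with hs | ⟨rfl | rfl, -⟩
  · obtain ⟨ht, h1 | h1⟩ := h s hs
    · exact entryMinors_eq_bot_of_rows ht h1.2.1 hr
    · exact entryMinors_eq_bot_of_columns ht h1.2.2.2 hc
  · exact entryMinors_eq_bot_of_rows (by simp) (by simp only; omega) hr
  · exact entryMinors_eq_bot_of_columns (by simp) (by simp only; omega) hc

theorem cornerIdeal_dropCorner_eq_bot (h : IsFirstCorner S b c τ) (hτ : 1 ≤ τ)
    (hw : ∀ p, p.1 < b ∨ c + τ < p.2 ∨ (p.1 = b ∧ c < p.2) → w p = 0) :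
    cornerIdeal w U (dropCorner S b c τ) = ⊥ := by
  rw [dropCorner, cornerIdeal_insert, entryMinors_eq_bot_of_rows (b := b + 1) hτ
    (by omega), bot_sup_eq, ← le_bot_iff]
  · refine (cornerIdeal_mono w U subset_shrinkCorner).trans
      (cornerIdeal_shrinkCorner_eq_bot (τ := τ) h fun p hp => hw p ?_).le
    tauto
  · intro p hp hb
    refine hw p ?_
    have := hp.2.2
    simp only at this
    omega

end Vanish

section Generic

variable (K : Type*) [Field K] (V : Set (ℕ × ℕ))

open Classical in
/-- The matrix with indeterminate entries at the positions in `V`, and zero elsewhere. -/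
noncomputable def genericMatrix (p : ℕ × ℕ) : MvPolynomial V K :=
  if h : p ∈ V then X ⟨p, h⟩ else 0

theorem genericMatrix_of_mem {p : ℕ × ℕ} (hp : p ∈ V) : genericMatrix K V p = X ⟨p, hp⟩ := by
  rw [genericMatrix, dif_pos hp]

variable {K V}

theorem eval_comp_genericMatrix {w : ℕ × ℕ → K} (hw : ∀ p, p ∉ V → w p = 0) :
    eval (fun v : V => w v) ∘ genericMatrix K V = w := by
  ext p
  by_cases hp : p ∈ V
  · simp [genericMatrix, hp]
  · simp [genericMatrix, hp, hw p hp]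

theorem notMem_cornerIdeal {U : Set (ℕ × ℕ)} {S : Finset (ℕ × ℕ × ℕ)} {w : ℕ × ℕ → K}
    (hw : ∀ p, p ∉ V → w p = 0) (hbot : cornerIdeal w U S = ⊥) {f : MvPolynomial V K}
    (hf : eval (fun v : V => w v) f ≠ 0) : f ∉ cornerIdeal (genericMatrix K V) U S := by
  intro hmem
  have := Ideal.mem_map_of_mem (eval fun v : V => w v) hmem
  rw [map_cornerIdeal, eval_comp_genericMatrix hw, hbot, Ideal.mem_bot] at this
  exact hf this

variable {U : Set (ℕ × ℕ)} {S : Finset (ℕ × ℕ × ℕ)} {b c τ : ℕ}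

open Classical in
theorem dropMinor_notMem (hU : IsOneSidedLadder U) (h : IsFirstCorner S b c τ)
    (hp : (b, c + τ) ∈ U)
    (hV : ∀ i j, b ≤ i → i < b + τ → c < j → j ≤ c + τ → (i, j) ∈ V) :
    dropMinor (genericMatrix K V) (baseIndex hU hp) ∉
      cornerIdeal (genericMatrix K V) U (shrinkCorner S b c τ) := by
  let w : ℕ × ℕ → K := fun p => if b ≤ p.1 ∧ p.1 < b + τ ∧ p.2 + b = p.1 + (c + 1) then 1 else 0
  have hw : ∀ p, p ∉ V → w p = 0 := by
    intro p hpV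
    refine if_neg fun hh => hpV (hV _ _ ?_ ?_ ?_ ?_) <;> omega
  refine notMem_cornerIdeal hw (cornerIdeal_shrinkCorner_eq_bot h fun p hp => if_neg (by omega)) ?_
  rw [map_dropMinor, eval_comp_genericMatrix hw, dropMinor, rowColMinor]
  convert one_ne_zero (α := K) using 1
  rw [← Matrix.det_one (n := Fin τ)]
  congr 1
  ext p q
  have h1 := p.2
  simp only [baseIndex, Matrix.of_apply, Matrix.one_apply, w, Fin.ext_iff]
  congr 1
  rw [eq_iff_iff]
  omega

open Classical in
theorem dropFull_notMem (hU : IsOneSidedLadder U) (h : IsFirstCorner S b c τ)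
    (hp : (b, c + τ) ∈ U)
    (hV : ∀ i j, b ≤ i → i ≤ b + τ → c ≤ j → j ≤ c + τ → (i, j) ∈ V) :
    dropFull (genericMatrix K V) (baseIndex hU hp) ∉
      cornerIdeal (genericMatrix K V) U (shrinkCorner S b c τ) := by
  let w : ℕ × ℕ → K := fun p => if (b ≤ p.1 ∧ p.1 < b + τ ∧ p.2 + b = p.1 + (c + 1)) ∨
    (p.1 = b + τ ∧ p.2 = c) then 1 else 0
  have hw : ∀ p, p ∉ V → w p = 0 := by
    intro p hpV
    refine if_neg fun hh => hpV (hV _ _ ?_ ?_ ?_ ?_) <;> omega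
  refine notMem_cornerIdeal hw (cornerIdeal_shrinkCorner_eq_bot h fun p hp => if_neg (by omega)) ?_
  rw [map_dropFull, eval_comp_genericMatrix hw, dropFull_eq, rowColMinor]
  convert one_ne_zero (α := K) using 1
  rw [← Matrix.det_one (n := Fin τ ⊕ Unit)]
  congr 1
  ext (p | p) (q | q) <;> simp only [baseIndex, Matrix.of_apply, Matrix.one_apply, w, Fin.ext_iff,
      Sum.elim_inl, Sum.elim_inr, Sum.inl.injEq, reduceCtorEq, if_true, if_false]
  · congr 1
    rw [eq_iff_iff]
    omega
  · exact if_neg (by omega)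
  · exact if_neg (by omega)
  · simp

open Classical in
theorem dropBorder_notMem (hU : IsOneSidedLadder U) (h : IsFirstCorner S b c τ) (hτ : 1 ≤ τ)
    (hp : (b, c + τ) ∈ U)
    (hV : ∀ i j, b ≤ i → i ≤ b + τ → c ≤ j → j ≤ c + τ → (i, j) ≠ (b + τ, c) → (i, j) ∈ V) :
    dropBorder (genericMatrix K V) (baseIndex hU hp) ∉
      cornerIdeal (genericMatrix K V) U (dropCorner S b c τ) := by
  let w : ℕ × ℕ → K := fun p => if (b < p.1 ∧ p.1 < b + τ ∧ p.2 + b = p.1 + (c + 1)) ∨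
    (p.1 = b ∧ p.2 = c) ∨ (p.1 = b + τ ∧ p.2 = c + 1) then 1 else 0
  have hw : ∀ p, p ∉ V → w p = 0 := by
    intro p hpV
    refine if_neg fun hh => hpV (hV _ _ ?_ ?_ ?_ ?_ ?_)
    · omega
    · omega
    · omega
    · omega
    · rw [Ne, Prod.ext_iff]
      simp only
      omega
  have hy : w (b + τ, c) = 0 := if_neg (by simp only; omega)
  refine notMem_cornerIdeal hw (cornerIdeal_dropCorner_eq_bot h hτ
    fun p hp => if_neg (by omega)) ?_
  have hd : dropBorder w (baseIndex hU hp) = dropFull w (baseIndex hU hp) := by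
    rw [dropFull, hy, zero_mul, zero_add]
  rw [map_dropBorder, eval_comp_genericMatrix hw, hd, dropFull_eq, rowColMinor]
  have hM : (Matrix.of fun p q => w
        (Sum.elim (baseIndex hU hp).1.1 (fun _ : Unit => b + τ) p,
          Sum.elim (baseIndex hU hp).1.2 (fun _ : Unit => c) q)) =
      (1 : Matrix (Fin τ ⊕ Unit) (Fin τ ⊕ Unit) K).submatrix
        (Equiv.swap (Sum.inl ⟨0, hτ⟩) (Sum.inr ())) id := by
    ext (p | p) (q | q) <;> simp only [baseIndex, Matrix.of_apply, Matrix.one_apply, w,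
      Sum.elim_inl, Sum.elim_inr, Matrix.submatrix_apply, id]
    · by_cases h0 : p = ⟨0, hτ⟩
      · subst h0
        rw [Equiv.swap_apply_left]
        simp only [reduceCtorEq, if_false]
        exact if_neg (by omega)
      · rw [Equiv.swap_apply_of_ne_of_ne (by simpa using h0) (by simp)]
        have : (p : ℕ) ≠ 0 := fun hh => h0 (Fin.ext hh)
        have := p.2
        congr 1
        simp only [Sum.inl.injEq, Fin.ext_iff, eq_iff_iff]
        omega
    · by_cases h0 : p = ⟨0, hτ⟩
      · subst h0
        rw [Equiv.swap_apply_left]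
        simp
      · rw [Equiv.swap_apply_of_ne_of_ne (by simpa using h0) (by simp)]
        have : (p : ℕ) ≠ 0 := fun hh => h0 (Fin.ext hh)
        simp only [reduceCtorEq, if_false]
        exact if_neg (by omega)
    · rw [Equiv.swap_apply_right]
      congr 1
      simp only [Sum.inl.injEq, Fin.ext_iff, eq_iff_iff, true_and]
      omega
    · rw [Equiv.swap_apply_right]
      simp only [reduceCtorEq, if_false]
      exact if_neg (by omega)
  rw [hM, Matrix.det_permute, Matrix.det_one, mul_one, Equiv.Perm.sign_swap (by simp)]
  simp

end Generic

section Prime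

open Classical in
/-- Singling out one element of a set. -/
noncomputable def Set.equivOptionDiff {α : Type*} {V : Set α} {y : α} (hy : y ∈ V) :
    V ≃ Option ↥(V \ {y}) where
  toFun v := if h : v.1 = y then none else some ⟨v.1, v.2, h⟩
  invFun o := o.elim ⟨y, hy⟩ fun v => ⟨v.1, Set.sdiff_subset v.2⟩
  left_inv v := by
    by_cases h : v.1 = y
    · simp only [dif_pos h]
      exact Subtype.ext h.symm
    · simp only [dif_neg h]
      rfl
  right_inv o := by
    rcases o with _ | v
    · exact dif_pos rfl
    · exact dif_neg v.2.2

/-- Singling out one indeterminate of `K[V]`. -/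
theorem exists_ringEquiv_polynomial (K : Type*) [Field K] {V : Set (ℕ × ℕ)} {y : ℕ × ℕ}
    (hy : y ∈ V) :
    ∃ e : MvPolynomial V K ≃+* Polynomial (MvPolynomial ↥(V \ {y}) K),
      e (genericMatrix K V y) = Polynomial.X ∧
      ∀ p, p ≠ y → e (genericMatrix K V p) = Polynomial.C (genericMatrix K (V \ {y}) p) := by
  refine ⟨((renameEquiv K (Set.equivOptionDiff hy)).trans
    (optionEquivLeft K ↥(V \ {y}))).toRingEquiv, ?_, fun p hp => ?_⟩
  · rw [genericMatrix_of_mem K V hy]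
    have : Set.equivOptionDiff hy ⟨y, hy⟩ = none := dif_pos rfl
    simp [this, optionEquivLeft_X_none]
  · by_cases hV : p ∈ V
    · rw [genericMatrix_of_mem K V hV, genericMatrix_of_mem K _ (⟨hV, hp⟩ : p ∈ V \ {y})]
      have : Set.equivOptionDiff hy ⟨p, hV⟩ = some ⟨p, hV, hp⟩ := dif_neg hp
      simp [this, optionEquivLeft_X_some]
    · simp [genericMatrix, hV]

variable {K : Type*} [Field K] {V U : Set (ℕ × ℕ)} {S : Finset (ℕ × ℕ × ℕ)} {b c τ : ℕ}

theorem block_subset (hU : IsOneSidedLadder U) (hp : (b, c + τ) ∈ U)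
    (hV : cornerSupport U (insert (b + τ + 1, c, τ + 1) S) ⊆ V) {i j : ℕ} (h₁ : b ≤ i)
    (h₂ : i ≤ b + τ) (h₃ : c ≤ j) (h₄ : j ≤ c + τ) : (i, j) ∈ V := by
  refine hV ?_
  rw [cornerSupport_insert]
  exact Or.inl ⟨hU hp h₁ h₄, by simp only; omega, h₃⟩

theorem dropMinor_congr {R : Type*} [CommRing R] {x x' : ℕ × ℕ → R}
    (h : ∀ p, p ≠ (b + τ, c) → x p = x' p) (k : DropIndex U b c τ) :
    dropMinor x k = dropMinor x' k := by
  rw [dropMinor, dropMinor, rowColMinor, rowColMinor]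
  congr 2
  ext p q
  refine h _ fun hh => ?_
  have := (k.2.2.2 p q).2.1
  rw [hh] at this
  exact lt_irrefl _ this

theorem dropBorder_congr {R : Type*} [CommRing R] {x x' : ℕ × ℕ → R}
    (h : ∀ p, p ≠ (b + τ, c) → x p = x' p) (k : DropIndex U b c τ) :
    dropBorder x k = dropBorder x' k := by
  refine borderMinor_congr (fun p q => h _ fun hh => ?_) (fun q => h _ fun hh => ?_)
    fun p => h _ fun hh => ?_
  · have := (k.2.2.2 p q).2.1
    rw [hh] at this
    exact lt_irrefl _ this
  · have := (k.2.2.2 q q).2.2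
    rw [(Prod.ext_iff.1 hh).2] at this
    exact Nat.not_succ_le_self _ this
  · have := (k.2.2.2 p p).2.1
    rw [(Prod.ext_iff.1 hh).1] at this
    exact lt_irrefl _ this

theorem cornerIdeal_dropCorner_zero {R : Type*} [CommRing R] (x : ℕ × ℕ → R) (U : Set (ℕ × ℕ))
    (S : Finset (ℕ × ℕ × ℕ)) (b c : ℕ) : cornerIdeal x U (dropCorner S b c 0) = ⊤ := by
  rw [Ideal.eq_top_iff_one]
  refine entryMinors_le_cornerIdeal x U (Finset.mem_insert_self _ _) ?_
  exact Ideal.subset_span ⟨Fin.elim0, Fin.elim0, fun i => i.elim0, fun i => i.elim0,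
    fun i => i.elim0, Matrix.det_fin_zero.symm⟩

theorem isPrime_cornerIdeal_insert (hU : IsOneSidedLadder U) (h : IsFirstCorner S b c τ)
    (hp : (b, c + τ) ∈ U) (hV : cornerSupport U (insert (b + τ + 1, c, τ + 1) S) ⊆ V)
    (hN : (cornerIdeal (genericMatrix K (V \ {(b + τ, c)})) U (shrinkCorner S b c τ)).IsPrime)
    (hC : 1 ≤ τ →
      (cornerIdeal (genericMatrix K (V \ {(b + τ, c)})) U (dropCorner S b c τ)).IsPrime) :
    (cornerIdeal (genericMatrix K V) U (insert (b + τ + 1, c, τ + 1) S)).IsPrime := by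
  have hy : (b + τ, c) ∈ V := block_subset hU hp hV (by omega) le_rfl le_rfl (by omega)
  set x₀ := genericMatrix K (V \ {(b + τ, c)}) with hx₀
  obtain ⟨e, hey, hne⟩ := exists_ringEquiv_polynomial K hy
  have hex : ∀ p, p ≠ (b + τ, c) → (e.toRingHom ∘ genericMatrix K V) p = (Polynomial.C ∘ x₀) p :=
    fun p hp => hne p hp
  have hprime := Polynomial.isPrime_map_C_sup_span_linear (cornerIdeal x₀ U (shrinkCorner S b c τ))
    (dropMinor x₀) (dropBorder x₀) (baseIndex hU hp)
    (dropMinor_notMem hU h hp fun i j h1 h2 h3 h4 =>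
      ⟨block_subset hU hp hV h1 h2.le h3.le h4, fun hh => by
        rw [Set.mem_singleton_iff, Prod.ext_iff] at hh; simp only at hh; omega⟩)
    (dropMinor_mul_dropBorder_sub_mem x₀ hU h hp) ?_
  · have hmap : (cornerIdeal (genericMatrix K V) U (insert (b + τ + 1, c, τ + 1) S)).map
        e.toRingHom = (cornerIdeal x₀ U (shrinkCorner S b c τ)).map Polynomial.C ⊔
          Ideal.span (Set.range fun k : DropIndex U b c τ =>
            Polynomial.X * Polynomial.C (dropMinor x₀ k) + Polynomial.C (dropBorder x₀ k)) := by
      rw [map_cornerIdeal, cornerIdeal_insert_eq _ hU h hp, map_cornerIdeal]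
      have h₁ : cornerIdeal (e.toRingHom ∘ genericMatrix K V) U (shrinkCorner S b c τ) =
          cornerIdeal (Polynomial.C ∘ x₀) U (shrinkCorner S b c τ) :=
        cornerIdeal_congr fun p hp => hex p (cornerSupport_shrinkCorner_subset U h hp).2
      have h₂ : (dropFull (e.toRingHom ∘ genericMatrix K V) : DropIndex U b c τ → _) = fun k =>
          Polynomial.X * Polynomial.C (dropMinor x₀ k) + Polynomial.C (dropBorder x₀ k) := by
        ext1 k
        rw [dropFull, dropMinor_congr hex, dropBorder_congr hex, map_dropMinor, map_dropBorder,
          Function.comp_apply]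
        exact congrArg (fun z => z * _ + _) hey
      rw [h₁, h₂]
    have hbij : Function.Bijective e.toRingHom := e.bijective
    rw [← hmap] at hprime
    have := hprime.comap e.toRingHom
    rwa [Ideal.comap_map_of_bijective _ hbij] at this
  · intro p hpm
    rw [cornerIdeal_shrinkCorner_sup_dropMinor] at hpm ⊢
    rcases Nat.eq_zero_or_pos τ with rfl | hτ
    · rw [cornerIdeal_dropCorner_zero]
      trivial
    · refine ((hC hτ).mem_or_mem hpm).resolve_right (dropBorder_notMem hU h hτ hp ?_)
      exact fun i j h1 h2 h3 h4 h5 => ⟨block_subset hU hp hV h1 h2 h3 h4, h5⟩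

end Prime

theorem ringKrullDim_quotient_add_one_le {R : Type*} [CommRing R] {N I : Ideal R} [N.IsPrime]
    (hle : N ≤ I) {f : R} (hf : f ∉ N) (hfI : f ∈ I) :
    ringKrullDim (R ⧸ I) + 1 ≤ ringKrullDim (R ⧸ N) := by
  have hreg : Ideal.Quotient.mk N f ∈ nonZeroDivisors (R ⧸ N) := by
    rw [mem_nonZeroDivisors_iff_ne_zero, Ne, Ideal.Quotient.eq_zero_iff_mem]
    exact hf
  refine le_trans ?_ (ringKrullDim_quotient_succ_le_of_nonZeroDivisor hreg)
  gcongr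
  refine ringKrullDim_le_of_surjective (Ideal.Quotient.lift _ (Ideal.Quotient.factor hle) ?_) ?_
  · intro a ha
    rw [Ideal.mem_span_singleton] at ha
    obtain ⟨b, rfl⟩ := ha
    rw [map_mul, Ideal.Quotient.factor_mk, Ideal.Quotient.eq_zero_iff_mem.2 hfI, zero_mul]
  · exact Ideal.Quotient.lift_surjective_of_surjective _ _ (Ideal.Quotient.factor_surjective hle)

section

variable {U : Set (ℕ × ℕ)}

theorem cornerHeightSet_subset_cornerSupport {S : Finset (ℕ × ℕ × ℕ)} (hS : IsCornerChain S) :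
    cornerHeightSet U S ⊆ cornerSupport U S := by
  rintro p ⟨hp, s, hs, h1, h2⟩
  have := hS.2 s hs
  exact Set.mem_biUnion hs ⟨hp, by omega, by omega⟩

theorem entryMinors_eq_bot_of_notMem {R : Type*} [CommRing R] (x : ℕ × ℕ → R)
    (hU : IsOneSidedLadder U) {d c t : ℕ} (ht : 1 ≤ t)
    (h : ¬(t ≤ d ∧ (d - t, c + t - 1) ∈ U)) (t₀ : ℕ) :
    entryMinors x (cornerRegion U (d, c, t₀)) t = ⊥ := by
  refine le_bot_iff.1 (entryMinors_le fun r cc hr hc hm => absurd ?_ h)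
  have h1 := hr.add_sub_le_of_fin (i := ⟨0, ht⟩) (j := ⟨t - 1, by omega⟩) (Nat.zero_le _)
  have h2 := hc.add_sub_le_of_fin (i := ⟨0, ht⟩) (j := ⟨t - 1, by omega⟩) (Nat.zero_le _)
  have h3 := (hm ⟨t - 1, by omega⟩ ⟨0, ht⟩).2
  have h4 := (hm ⟨0, ht⟩ ⟨t - 1, by omega⟩).1
  simp only at h1 h2 h3
  exact ⟨by omega, hU h4 (by omega) (by omega)⟩

theorem cornerHeightSet_insert_of_notMem (hU : IsOneSidedLadder U) {S : Finset (ℕ × ℕ × ℕ)}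
    {d c t : ℕ} (ht : 1 ≤ t) (h : ¬(t ≤ d ∧ (d - t, c + t - 1) ∈ U)) :
    cornerHeightSet U (insert (d, c, t) S) = cornerHeightSet U S := by
  ext p
  simp only [cornerHeightSet, Set.mem_ofPred_eq, Finset.exists_mem_insert]
  refine and_congr_right fun hp => or_iff_right fun hh => h ?_
  exact ⟨by omega, hU hp (by omega) (by omega)⟩

/-- The properties of a mixed one-sided ladder determinantal ideal that are proved simultaneously by
induction: it is prime, and its quotient has depth at least, and dimension at most, the expected
one. -/
structure IsGoodCornerIdeal.{u} (K : Type u) [Field K] (V U : Set (ℕ × ℕ))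
    (S : Finset (ℕ × ℕ × ℕ)) : Prop where
  isPrime : (cornerIdeal (genericMatrix K V) U S).IsPrime
  subsingleton_ext : ∀ P : Ideal (MvPolynomial V K), P.IsMaximal → ∀ i : ℕ,
    i + (cornerHeightSet U S).ncard < V.ncard →
    Subsingleton (CategoryTheory.Abelian.Ext
      (ModuleCat.of (MvPolynomial V K) (MvPolynomial V K ⧸ P))
      (ModuleCat.of (MvPolynomial V K)
        (MvPolynomial V K ⧸ cornerIdeal (genericMatrix K V) U S)) i)
  dim_add_le : ringKrullDim (MvPolynomial V K ⧸ cornerIdeal (genericMatrix K V) U S) +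
    (cornerHeightSet U S).ncard ≤ V.ncard

variable {K : Type*} [Field K] {V : Set (ℕ × ℕ)}

theorem isGoodCornerIdeal_empty (hV : V.Finite) : IsGoodCornerIdeal K V U ∅ := by
  have hI : cornerIdeal (genericMatrix K V) U ∅ = ⊥ := by simp [cornerIdeal]
  have hH : cornerHeightSet U ∅ = ∅ := by ext; simp [cornerHeightSet]
  have := hV.to_subtype
  refine ⟨?_, fun P hP i hi => ?_, ?_⟩
  · rw [hI]
    exact Ideal.isPrime_bot
  · rw [hH, Set.ncard_empty, add_zero] at hi
    have := MvPolynomial.subsingleton_ext_of_isMaximal (V : Type _) P hP i (by simpa using hi)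
    rw [hI]
    let e : (ModuleCat.of (MvPolynomial V K) (MvPolynomial V K)) ≅
      (ModuleCat.of (MvPolynomial V K) (MvPolynomial V K ⧸ (⊥ : Ideal (MvPolynomial V K)))) :=
      (Submodule.quotEquivOfEqBot (⊥ : Ideal (MvPolynomial V K)) rfl).symm.toModuleIso
    refine subsingleton_of_forall_eq 0 fun x => ?_
    rw [← CategoryTheory.Abelian.Ext.comp_mk₀_id x, ← e.inv_hom_id,
      ← CategoryTheory.Abelian.Ext.mk₀_comp_mk₀,
      ← CategoryTheory.Abelian.Ext.comp_assoc_of_second_deg_zero,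
      this.elim (x.comp (CategoryTheory.Abelian.Ext.mk₀ e.inv) (add_zero _)) 0,
      CategoryTheory.Abelian.Ext.zero_comp]
  · rw [hH, Set.ncard_empty, hI, Nat.cast_zero, add_zero,
      ringKrullDim_eq_of_ringEquiv (RingEquiv.quotientBot (MvPolynomial V K)),
      MvPolynomial.ringKrullDim_of_isNoetherianRing, ringKrullDim_eq_zero_of_field, zero_add]
    simp

theorem isGoodCornerIdeal_insert (hU : IsOneSidedLadder U) {S : Finset (ℕ × ℕ × ℕ)} {b c τ : ℕ}
    (h : IsFirstCorner S b c τ) (hp : (b, c + τ) ∈ U) (hVf : V.Finite)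
    (hV : cornerSupport U (insert (b + τ + 1, c, τ + 1) S) ⊆ V) (hS : IsCornerChain S)
    (hN : IsGoodCornerIdeal K V U (shrinkCorner S b c τ))
    (hC : 1 ≤ τ → IsGoodCornerIdeal K V U (dropCorner S b c τ))
    (hN' : IsGoodCornerIdeal K (V \ {(b + τ, c)}) U (shrinkCorner S b c τ))
    (hC' : 1 ≤ τ → IsGoodCornerIdeal K (V \ {(b + τ, c)}) U (dropCorner S b c τ)) :
    IsGoodCornerIdeal K V U (insert (b + τ + 1, c, τ + 1) S) := by
  have hfin : (cornerHeightSet U (shrinkCorner S b c τ)).Finite :=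
    hVf.subset (((cornerHeightSet_subset_cornerSupport (isCornerChain_shrinkCorner hS)).trans
      (cornerSupport_shrinkCorner_subset U h)).trans (Set.sdiff_subset.trans hV))
  have hcard : (cornerHeightSet U (insert (b + τ + 1, c, τ + 1) S)).ncard =
      (cornerHeightSet U (shrinkCorner S b c τ)).ncard + 1 := by
    rw [cornerHeightSet_insert U h hp,
      Set.ncard_insert_of_notMem (notMem_cornerHeightSet_shrinkCorner U h) hfin]
  have hprimeN := hN.isPrime
  have hI := cornerIdeal_insert_eq (genericMatrix K V) hU h hp
  have hJ := cornerIdeal_shrinkCorner_sup_dropMinor (genericMatrix K V) (U := U) (S := S)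
    (b := b) (c := c) (τ := τ)
  have hf : dropFull (genericMatrix K V) (baseIndex hU hp) ∉
      cornerIdeal (genericMatrix K V) U (shrinkCorner S b c τ) :=
    dropFull_notMem hU h hp fun i j => block_subset hU hp hV
  have hq : dropMinor (genericMatrix K V) (baseIndex hU hp) ∉
      cornerIdeal (genericMatrix K V) U (shrinkCorner S b c τ) :=
    dropMinor_notMem hU h hp fun i j h1 h2 h3 h4 => block_subset hU hp hV h1 h2.le h3.le h4
  refine ⟨isPrime_cornerIdeal_insert hU h hp hV hN'.isPrime fun hτ => (hC' hτ).isPrime,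
    fun P hP i hi => ?_, ?_⟩
  · obtain ⟨e⟩ := Ideal.exists_linearEquiv_map_mkQ_sup_span
      (cornerIdeal (genericMatrix K V) U (shrinkCorner S b c τ)) (dropMinor (genericMatrix K V))
      (dropFull (genericMatrix K V)) (baseIndex hU hp) hq hf
      (dropFull_mul_dropMinor_sub_mem _ hU h hp)
    rw [hI]
    refine Submodule.subsingleton_ext_quotient_of_linearEquiv _ le_sup_left le_sup_left e i
      (hN.subsingleton_ext P hP i (by omega)) (hN.subsingleton_ext P hP (i + 1) (by omega)) ?_
    rw [hJ]
    rcases Nat.eq_zero_or_pos τ with rfl | hτ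
    · have htop : cornerIdeal (genericMatrix K V) U (dropCorner S b c 0) = ⊤ :=
        cornerIdeal_dropCorner_zero _ _ _ _ _
      have : Subsingleton (MvPolynomial V K ⧸
          cornerIdeal (genericMatrix K V) U (dropCorner S b c 0)) :=
        Ideal.Quotient.subsingleton_iff.2 htop
      exact ModuleCat.subsingleton_ext_of_subsingleton _ _ _
    · refine (hC hτ).subsingleton_ext P hP i ?_
      rwa [cornerHeightSet_dropCorner]
  · have hfI : dropFull (genericMatrix K V) (baseIndex hU hp) ∈
        cornerIdeal (genericMatrix K V) U (insert (b + τ + 1, c, τ + 1) S) := by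
      rw [hI]
      exact Ideal.mem_sup_right (Ideal.subset_span ⟨_, rfl⟩)
    have := ringKrullDim_quotient_add_one_le (hI ▸ le_sup_left) hf hfI
    refine le_trans (le_trans (le_of_eq ?_) (add_le_add_left this _)) hN.dim_add_le
    rw [hcard, Nat.cast_add, Nat.cast_one]
    exact (add_assoc _ _ _).symm.trans (add_right_comm _ _ _)

theorem isGoodCornerIdeal (hU : IsOneSidedLadder U) {S : Finset (ℕ × ℕ × ℕ)}
    (hS : IsCornerChain S) (hVf : V.Finite) (hV : cornerSupport U S ⊆ V) :
    IsGoodCornerIdeal K V U S := by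
  induction hn : 2 * (cornerSupport U S).ncard + S.card using Nat.strong_induction_on
    generalizing S V with
  | _ n ih =>
  subst hn
  rcases S.eq_empty_or_nonempty with rfl | hne
  · exact isGoodCornerIdeal_empty hVf
  obtain ⟨⟨d, c, t⟩, hs, hfirst⟩ := hS.exists_isFirstCorner hne
  have ht := hS.2 _ hs
  have hcard := Finset.card_erase_add_one hs
  obtain ⟨S, rfl, hs'⟩ : ∃ S', S = insert (d, c, t) S' ∧ (d, c, t) ∉ S' :=
    ⟨S.erase (d, c, t), (Finset.insert_erase hs).symm, Finset.notMem_erase _ _⟩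
  rw [Finset.erase_insert hs'] at hcard hfirst
  have hS' : IsCornerChain S := by
    have := hS.erase (d, c, t)
    rwa [Finset.erase_insert hs'] at this
  simp only at ht hfirst
  have hfin := hVf.subset hV
  by_cases hmem : t ≤ d ∧ (d - t, c + t - 1) ∈ U
  · obtain ⟨τ, rfl⟩ : ∃ τ, t = τ + 1 := ⟨t - 1, by omega⟩
    obtain ⟨b, rfl⟩ : ∃ b, d = b + τ + 1 := ⟨d - (τ + 1), by omega⟩
    have h : IsFirstCorner S b c τ := fun s hs => by
      have := hfirst s hs
      omega
    have hp : (b, c + τ) ∈ U := by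
      convert hmem.2 using 2 <;> omega
    have hy : (b + τ, c) ∈ cornerSupport U (insert (b + τ + 1, c, τ + 1) S) :=
      block_subset (V := cornerSupport U (insert (b + τ + 1, c, τ + 1) S)) hU hp subset_rfl
        (by omega) le_rfl le_rfl (by omega)
    have hlt : (cornerSupport U (insert (b + τ + 1, c, τ + 1) S) \ {(b + τ, c)}).ncard + 1 =
      (cornerSupport U (insert (b + τ + 1, c, τ + 1) S)).ncard :=
      Set.ncard_sdiff_singleton_add_one hy hfin
    have hN := cornerSupport_shrinkCorner_subset U h
    have hC := cornerSupport_dropCorner_subset U h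
    have hNle := Set.ncard_le_ncard hN (hfin.subset Set.sdiff_subset)
    have hCle := Set.ncard_le_ncard hC (hfin.subset Set.sdiff_subset)
    have hNcard : (shrinkCorner S b c τ).card ≤ S.card + 2 := card_shrinkCorner_le
    have hCcard : (dropCorner S b c τ).card ≤ S.card + 1 := Finset.card_insert_le _ _
    have hNc := isCornerChain_shrinkCorner (b := b) (c := c) (τ := τ) hS'
    have hV' := Set.sdiff_subset_sdiff_left (t := {(b + τ, c)}) hV
    refine isGoodCornerIdeal_insert hU h hp hVf hV hS' ?_ ?_ ?_ ?_
    · exact ih _ (by omega) hNc hVf (hN.trans (Set.sdiff_subset.trans hV)) rfl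
    · exact fun hτ => ih _ (by omega) (isCornerChain_dropCorner hS' h hτ) hVf
        (hC.trans (Set.sdiff_subset.trans hV)) rfl
    · exact ih _ (by omega) hNc (hVf.subset Set.sdiff_subset) (hN.trans hV') rfl
    · exact fun hτ => ih _ (by omega) (isCornerChain_dropCorner hS' h hτ)
        (hVf.subset Set.sdiff_subset) (hC.trans hV') rfl
  · have hI : cornerIdeal (genericMatrix K V) U (insert (d, c, t) S) =
        cornerIdeal (genericMatrix K V) U S := by
      rw [cornerIdeal_insert, entryMinors_eq_bot_of_notMem _ hU ht hmem, bot_sup_eq]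
    have hH := cornerHeightSet_insert_of_notMem hU (S := S) ht hmem
    have hsub : cornerSupport U S ⊆ cornerSupport U (insert (d, c, t) S) := by
      rw [cornerSupport_insert]
      exact Set.subset_union_right
    have hle := Set.ncard_le_ncard hsub hfin
    have hgood := ih _ (by omega) hS' hVf (hsub.trans hV) rfl
    refine ⟨?_, ?_, ?_⟩
    · rw [hI]
      exact hgood.isPrime
    · rw [hI, hH]
      exact hgood.subsingleton_ext
    · rw [hI, hH]
      exact hgood.dim_add_le

end

/-- A quotient of a Noetherian ring is Cohen–Macaulay if its dimension is at most `n` and the `Ext`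
modules that compute its depth at the maximal ideals vanish below degree `n`. -/
theorem isCohenMacaulayRing_quotient {R : Type*} [CommRing R] [IsNoetherianRing R] {I : Ideal R}
    {n : ℕ} (hdim : ringKrullDim (R ⧸ I) ≤ n)
    (hext : ∀ P : Ideal R, P.IsMaximal → ∀ i < n, Subsingleton
      (CategoryTheory.Abelian.Ext (ModuleCat.of R (R ⧸ P)) (ModuleCat.of R (R ⧸ I)) i)) :
    IsCohenMacaulayRing (R ⧸ I) := by
  refine ⟨inferInstance, fun P hP => ?_⟩
  have hQ : (P.comap (Ideal.Quotient.mk I)).IsMaximal :=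
    Ideal.comap_isMaximal_of_surjective _ Ideal.Quotient.mk_surjective
  set Q := P.comap (Ideal.Quotient.mk I) with hQdef
  have hIQ : I ≤ Q := fun x hx => by
    rw [hQdef, Ideal.mem_comap, Ideal.Quotient.eq_zero_iff_mem.2 hx]
    exact P.zero_mem
  have hlt : Q • (⊤ : Submodule R (R ⧸ I)) < ⊤ := by
    refine lt_top_iff_ne_top.2 fun h => hP.ne_top ((Ideal.eq_top_iff_one P).2 ?_)
    have h1 : (1 : R ⧸ I) ∈ Q • (⊤ : Submodule R (R ⧸ I)) := by
      rw [h]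
      exact Submodule.mem_top
    refine (Submodule.smul_le (P := P.restrictScalars R)).2 (fun r hr x _ => ?_) h1
    rw [Algebra.smul_def]
    exact P.mul_mem_right _ hr
  obtain ⟨rs, hlen, hmem, hreg⟩ := ModuleCat.exists_isRegular_of_exists_subsingleton_ext Q n
    (ModuleCat.of R (R ⧸ I)) hlt (ModuleCat.of R (R ⧸ Q))
    (by
      change Module.support R (R ⧸ Q) = _
      rw [Module.support_eq_zeroLocus, Ideal.annihilator_quotient])
    (hext Q hQ)
  have hweak := (RingTheory.Sequence.isWeaklyRegular_map_algebraMap_iff (R ⧸ I) (R ⧸ I) rs).2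
    hreg.toIsWeaklyRegular
  have hloc := hweak.isRegular_of_isLocalization_of_mem (Localization.AtPrime P) P (by
    intro r hr
    obtain ⟨s, hs, rfl⟩ := List.mem_map.1 hr
    exact hmem s hs)
  refine ⟨_, fun x hx => ?_, hloc, le_antisymm ?_ ?_⟩
  · obtain ⟨y, hy, rfl⟩ := List.mem_map.1 hx
    obtain ⟨s, hs, rfl⟩ := List.mem_map.1 hy
    exact (IsLocalization.AtPrime.to_map_mem_maximal_iff _ P _).2 (hmem s hs)
  · rw [← ringKrullDim_add_length_eq_ringKrullDim_of_isRegular _ hloc]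
    have : Nontrivial (Localization.AtPrime P ⧸ Ideal.ofList
        ((rs.map (algebraMap R (R ⧸ I))).map (algebraMap _ (Localization.AtPrime P)))) := by
      refine Ideal.Quotient.nontrivial_iff.2 fun h => hloc.top_ne_smul ?_
      rw [h, Submodule.top_smul]
    exact le_add_of_nonneg_left ringKrullDim_nonneg_of_nontrivial
  · rw [List.length_map, List.length_map, hlen, IsLocalization.AtPrime.ringKrullDim_eq_height P]
    exact (Ideal.height_le_ringKrullDim_of_isPrime).trans hdim

namespace LadderData

variable (D : LadderData)

/-- The one-sided ladder cut out by the upper outside corners alone. -/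
def upperLadder : Set (ℕ × ℕ) :=
  {p | ∃ i, D.b i ≤ p.1 ∧ p.2 ≤ D.a i}

/-- The triple describing the `j`-th lower outside corner. -/
def corner (j : Fin D.k) : ℕ × ℕ × ℕ :=
  (D.d j + 1, D.c j, D.t j)

/-- The triples describing all lower outside corners. -/
def corners : Finset (ℕ × ℕ × ℕ) :=
  Finset.univ.image D.corner

theorem isOneSidedLadder_upperLadder : IsOneSidedLadder D.upperLadder := by
  rintro i j i' j' ⟨l, h1, h2⟩ hi hj
  exact ⟨l, h1.trans hi, hj.trans h2⟩

theorem cornerLT_corner {j j' : Fin D.k} (hjj : j < j') :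
    CornerLT (D.corner j) (D.corner j') := by
  obtain ⟨j, hj⟩ := j
  obtain ⟨j', hj'⟩ := j'
  have hlt : j + 1 ≤ j' := hjj
  have : D.d ⟨j, hj⟩ + D.t ⟨j', hj'⟩ < D.d ⟨j', hj'⟩ + D.t ⟨j, hj⟩ ∧
      D.c ⟨j, hj⟩ + D.t ⟨j, hj⟩ < D.c ⟨j', hj'⟩ + D.t ⟨j', hj'⟩ := by
    clear hjj
    induction j', hlt using Nat.le_induction with
    | base => exact ⟨D.step_d j hj', D.step_c j hj'⟩
    | succ l hl ih =>
      have h1 := D.step_d l hj'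
      have h2 := D.step_c l hj'
      have h3 := ih (Nat.lt_of_succ_lt hj')
      omega
  have h1 := D.d_mono hjj.le
  have h2 := D.c_mono hjj.le
  refine ⟨?_, ?_, ?_, ?_⟩ <;> simp only [corner] <;> omega

theorem isCornerChain_corners : IsCornerChain D.corners := by
  simp only [IsCornerChain, corners, Finset.mem_image, Finset.mem_univ, true_and]
  refine ⟨?_, ?_⟩
  · rintro _ ⟨j, rfl⟩ _ ⟨j', rfl⟩ hne
    rcases lt_trichotomy j j' with h | rfl | h
    · exact Or.inl (D.cornerLT_corner h)
    · exact absurd rfl hne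
    · exact Or.inr (D.cornerLT_corner h)
  · rintro _ ⟨j, rfl⟩
    exact D.t_pos j

theorem cornerRegion_corner (j : Fin D.k) :
    cornerRegion D.upperLadder (D.corner j) = D.Lj j := by
  ext p
  constructor
  · rintro ⟨⟨i, hb, ha⟩, hd, hc⟩
    have h1 : p.1 ≤ D.d j := Nat.lt_succ_iff.1 hd
    have h2 : D.c j ≤ p.2 := hc
    have h3 : D.d j ≤ D.m := D.d_last ▸ D.d_mono (Fin.mk_le_mk.2 (by omega))
    have h4 : 1 ≤ D.b i := D.b_first ▸ D.b_mono.monotone (Fin.mk_le_mk.2 (Nat.zero_le _))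
    have h5 : 1 ≤ D.c j := D.c_first ▸ D.c_mono (Fin.mk_le_mk.2 (Nat.zero_le _))
    have h6 : D.a i ≤ D.n := D.a_last ▸ D.a_mono.monotone (Fin.mk_le_mk.2 (by omega))
    exact ⟨⟨i, j, by omega⟩, h1, h2⟩
  · rintro ⟨⟨i, j', h⟩, h1, h2⟩
    exact ⟨⟨i, h.1, h.2.2.2.1⟩, Nat.lt_succ_iff.2 h1, h2⟩

theorem cornerSupport_corners_subset : cornerSupport D.upperLadder D.corners ⊆ D.L := by
  refine Set.iUnion₂_subset fun s hs => ?_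
  obtain ⟨j, -, rfl⟩ := Finset.mem_image.1 hs
  rw [cornerRegion_corner]
  exact fun p hp => hp.1

theorem finite_L : D.L.Finite := by
  refine ((Set.finite_Iic D.m).prod (Set.finite_Iic D.n)).subset ?_
  rintro p ⟨i, j, h⟩
  exact ⟨h.2.1, h.2.2.2.2.2.2.2⟩

theorem It_eq_cornerIdeal (K : Type*) [Field K] :
    D.It K = cornerIdeal (genericMatrix K D.L) D.upperLadder D.corners := by
  rw [It, cornerIdeal, corners, Finset.iSup_finset_image]
  simp only [Finset.mem_univ, iSup_pos, cornerRegion_corner]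
  refine iSup_congr fun j => congrArg Ideal.span (Set.ext fun f => ?_)
  constructor
  · rintro ⟨r, cc, hr, hc, hm, hmem, rfl⟩
    refine ⟨r, cc, hr, hc, hm, congrArg Matrix.det (Matrix.ext fun p q => ?_)⟩
    exact (genericMatrix_of_mem K D.L (hmem p q)).symm
  · rintro ⟨r, cc, hr, hc, hm, rfl⟩
    refine ⟨r, cc, hr, hc, hm, fun p q => (hm p q).1,
      congrArg Matrix.det (Matrix.ext fun p q => ?_)⟩
    exact genericMatrix_of_mem K D.L (hm p q).1

end LadderData

/-- **Theorem (Cohen–Macaulayness).** For every mixed ladder determinantal ideal `I_t(L)`,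
the quotient `K[L]/I_t(L)` is a Cohen–Macaulay ring. -/
theorem mixedLadderDeterminantal_isCohenMacaulay (K : Type*) [Field K]
    (D : LadderData) (hnd : D.Nondeg) :
    IsCohenMacaulayRing (MvPolynomial ↥D.L K ⧸ D.It K) := by
  have := D.finite_L.to_subtype
  have hgood : IsGoodCornerIdeal K D.L D.upperLadder D.corners :=
    isGoodCornerIdeal D.isOneSidedLadder_upperLadder D.isCornerChain_corners D.finite_L
      D.cornerSupport_corners_subset
  have hle := Set.ncard_le_ncard ((cornerHeightSet_subset_cornerSupport (U := D.upperLadder)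
    D.isCornerChain_corners).trans D.cornerSupport_corners_subset) D.finite_L
  obtain ⟨n, hn⟩ := Nat.exists_eq_add_of_le' hle
  rw [D.It_eq_cornerIdeal]
  refine isCohenMacaulayRing_quotient (n := n) ?_ fun P hP i hi =>
    hgood.subsingleton_ext P hP i (by omega)
  have := hgood.dim_add_le
  rw [hn, Nat.cast_add] at this
  exact ENat.WithBot.add_le_add_natCast_right_iff.1 this
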